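/- Let Ω ⊂ ℝⁿ be a Lipschitz domain with constants m, r₀, let Q = Ω × (0,∞), let L be a nondivergence parabolic operator on Q with ellipticity constant ν, and let (ω^X) be the L-caloric measure for Q. Let Y = (y,s) ∈ ∂_pQ and 0 < r ≤ r₀/2. Then there exists N = N(n, ν, m) ≥ 1 such that ω^X(Δ_{2r}(Y)) ≥ 1/N for every X ∈ Q_r(Y). -/

import Mathlib

open MeasureTheory Set Metric Filter

noncomputable section

/-- Euclidean space `ℝⁿ`. -/
abbrev E (n : ℕ) : Type := EuclideanSpace ℝ (Fin n)

/-- Second spatial partial derivative `D_i D_j u` at a space-time point `X`. -/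
def D2 {n : ℕ} (u : E n × ℝ → ℝ) (X : E n × ℝ) (i j : Fin n) : ℝ :=
  fderiv ℝ (fun x => fderiv ℝ (fun x' => u (x', X.2)) x (EuclideanSpace.single j 1))
    X.1 (EuclideanSpace.single i 1)

/-- Time derivative `D_t u` at a space-time point `X`. -/
def Dt {n : ℕ} (u : E n × ℝ → ℝ) (X : E n × ℝ) : ℝ :=
  deriv (fun t => u (X.1, t)) X.2

/-- The value `Lu(X)` of the nondivergence parabolic operator with coefficients `a`. -/
def LVal {n : ℕ} (a : E n × ℝ → Fin n → Fin n → ℝ) (u : E n × ℝ → ℝ) (X : E n × ℝ) : ℝ :=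
  (∑ i, ∑ j, a X i j * D2 u X i j) - Dt u X

/-- `u` is C² in `x` and C¹ in `t` at every point of `V`. -/
def ParabolicSmoothOn {n : ℕ} (u : E n × ℝ → ℝ) (V : Set (E n × ℝ)) : Prop :=
  ∀ X ∈ V, ContDiffAt ℝ 2 (fun x => u (x, X.2)) X.1 ∧
    DifferentiableAt ℝ (fun t => u (X.1, t)) X.2

/-- `u` solves `Lu = 0` pointwise in `V` (being C² in `x`, C¹ in `t` there). -/
def SolvesL {n : ℕ} (a : E n × ℝ → Fin n → Fin n → ℝ) (u : E n × ℝ → ℝ)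
    (V : Set (E n × ℝ)) : Prop :=
  ParabolicSmoothOn u V ∧ ∀ X ∈ V, LVal a u X = 0

/-- `a` is a smooth coefficient matrix on `S`, uniformly elliptic with constant `ν`
and with entries bounded by `ν⁻¹`. -/
def IsParabolicCoeff {n : ℕ} (ν : ℝ) (a : E n × ℝ → Fin n → Fin n → ℝ)
    (S : Set (E n × ℝ)) : Prop :=
  (∀ i j, ContDiffOn ℝ (⊤ : ℕ∞) (fun X => a X i j) S) ∧
  ∀ X ∈ S, (∀ ξ : Fin n → ℝ, ν * ∑ i, ξ i ^ 2 ≤ ∑ i, ∑ j, a X i j * ξ i * ξ j) ∧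
    ∀ i j, |a X i j| ≤ ν⁻¹

/-- The cylinder `Ω × (t₀, ∞)`. -/
def CylFrom {n : ℕ} (Ω : Set (E n)) (t₀ : ℝ) : Set (E n × ℝ) := Ω ×ˢ Ioi t₀

/-- The cylinder `Q = Ω × (0, ∞)`. -/
def Cyl {n : ℕ} (Ω : Set (E n)) : Set (E n × ℝ) := CylFrom Ω 0

/-- Parabolic boundary of the cylinder `Ω × (t₀, ∞)`:
`(∂Ω × (t₀,∞)) ∪ (cl(Ω) × {t₀})`. -/
def pBFrom {n : ℕ} (Ω : Set (E n)) (t₀ : ℝ) : Set (E n × ℝ) :=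
  (frontier Ω ×ˢ Ioi t₀) ∪ (closure Ω ×ˢ {t₀})

/-- Parabolic boundary of `Ω × (0, ∞)`. -/
def pB {n : ℕ} (Ω : Set (E n)) : Set (E n × ℝ) := pBFrom Ω 0

/-- The cylinder `C_{R,r}(Y) = B_R(y) × (s - r², s + r²)`. -/
def CRr {n : ℕ} (Y : E n × ℝ) (R r : ℝ) : Set (E n × ℝ) :=
  ball Y.1 R ×ˢ Ioo (Y.2 - r ^ 2) (Y.2 + r ^ 2)

/-- The standard cylinder `C_r(Y) = B_r(y) × (s - r², s + r²)`. -/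
def Cr {n : ℕ} (Y : E n × ℝ) (r : ℝ) : Set (E n × ℝ) := CRr Y r r

/-- `ω` is the `L`-caloric measure family for the cylinder `Ω × (t₀, ∞)`:
each `ω X` is a Borel probability measure on the parabolic boundary, and for every
bounded continuous `φ`, `X ↦ ∫ φ dω^X` is a (bounded) solution of `Lu = 0` in the
cylinder extending continuously to `φ` at each point of the parabolic boundary. -/
def IsCaloricMeasureFrom {n : ℕ} (a : E n × ℝ → Fin n → Fin n → ℝ) (Ω : Set (E n))
    (t₀ : ℝ) (ω : E n × ℝ → Measure (E n × ℝ)) : Prop :=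
  (∀ X ∈ CylFrom Ω t₀, IsProbabilityMeasure (ω X) ∧ ω X (pBFrom Ω t₀)ᶜ = 0) ∧
  ∀ φ : E n × ℝ → ℝ, Continuous φ → (∃ M, ∀ z, |φ z| ≤ M) →
    SolvesL a (fun X => ∫ z, φ z ∂ω X) (CylFrom Ω t₀) ∧
    ∀ Z ∈ pBFrom Ω t₀, Tendsto (fun X => ∫ z, φ z ∂ω X)
      (nhdsWithin Z (CylFrom Ω t₀)) (nhds (φ Z))

/-- `ω` is the `L`-caloric measure family for `Q = Ω × (0, ∞)`. -/
def IsCaloricMeasure {n : ℕ} (a : E n × ℝ → Fin n → Fin n → ℝ) (Ω : Set (E n))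
    (ω : E n × ℝ → Measure (E n × ℝ)) : Prop :=
  IsCaloricMeasureFrom a Ω 0 ω

/-- `Ω` is a Lipschitz domain with constants `m, r₀ > 0`: it is a nonempty open
connected set and near each boundary point, in a suitable orthonormal coordinate
system centered at that point, it coincides with the region above the graph of a
function with `‖∇φ‖_{L^∞} ≤ m` (equivalently, `m`-Lipschitz). -/
def IsLipschitzDomain {n : ℕ} (hn : 0 < n) (Ω : Set (E n)) (m r₀ : ℝ) : Prop :=
  IsOpen Ω ∧ Ω.Nonempty ∧ IsConnected Ω ∧ 0 < m ∧ 0 < r₀ ∧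
  ∀ y ∈ frontier Ω, ∃ (T : E n ≃ₗᵢ[ℝ] E n) (φ : E (n - 1) → ℝ),
    LipschitzWith m.toNNReal φ ∧
    ∀ x : E n, x ∈ Ω ∩ ball y r₀ ↔
      ‖x - y‖ < r₀ ∧
        φ ((EuclideanSpace.equiv (Fin (n - 1)) ℝ).symm
            (fun i => T (x - y) (Fin.castLE (Nat.sub_le n 1) i))) <
          T (x - y) ⟨n - 1, Nat.sub_lt hn Nat.one_pos⟩

/-- The set `Ω^δ = {x ∈ Ω : dist(x, ∂Ω) > δ}`. -/
def innerSet {n : ℕ} (Ω : Set (E n)) (δ : ℝ) : Set (E n) :=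
  {x ∈ Ω | δ < infDist x (frontier Ω)}

/-- The corkscrew property (2.3) with constant `μ`. -/
def Corkscrew {n : ℕ} (Ω : Set (E n)) (r₀ μ : ℝ) : Prop :=
  ∀ y ∈ frontier Ω, ∀ r : ℝ, 0 < r → r < r₀ →
    (∃ y₁ : E n, ball y₁ (2 * μ * r) ⊆ ball y r ∩ Ω) ∧
    (∃ y₂ : E n, ball y₂ (2 * μ * r) ⊆ ball y r \ Ω)


/-- Second partial derivatives of a function of `x` only. -/
def D2x {n : ℕ} (f : E n → ℝ) (x : E n) (i j : Fin n) : ℝ :=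
  fderiv ℝ (fun x => fderiv ℝ f x (EuclideanSpace.single j 1)) x (EuclideanSpace.single i 1)

theorem D2_eq_D2x {n : ℕ} (u : E n × ℝ → ℝ) (X : E n × ℝ) (i j : Fin n) :
    D2 u X i j = D2x (fun x => u (x, X.2)) X.1 i j := rfl

theorem cd_fderiv_apply {n : ℕ} {f : E n → ℝ} {x : E n} (hf : ContDiffAt ℝ 2 f x) (v : E n) :
    ContDiffAt ℝ 1 (fun x => fderiv ℝ f x v) x := by
  have h : ContDiffAt ℝ 1 (fderiv ℝ f) x := hf.fderiv_right (by norm_num)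
  exact h.clm_apply contDiffAt_const

theorem cd_two_differentiable {n : ℕ} {f : E n → ℝ} {x : E n} (hf : ContDiffAt ℝ 2 f x) :
    DifferentiableAt ℝ f x := hf.differentiableAt (by norm_num)

theorem cd_two_eventually {n : ℕ} {f : E n → ℝ} {x : E n} (hf : ContDiffAt ℝ 2 f x) :
    ∀ᶠ y in nhds x, ContDiffAt ℝ 2 f y := hf.eventually (by norm_num)

theorem D2x_congr {n : ℕ} {f g : E n → ℝ} {x : E n} (h : f =ᶠ[nhds x] g) (i j : Fin n) :
    D2x f x i j = D2x g x i j := by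
  unfold D2x
  have : (fun x => fderiv ℝ f x (EuclideanSpace.single j 1)) =ᶠ[nhds x]
      (fun x => fderiv ℝ g x (EuclideanSpace.single j 1)) := by
    filter_upwards [h.fderiv (𝕜 := ℝ)] with y hy
    rw [hy]
  rw [this.fderiv_eq]

theorem D2x_sub {n : ℕ} {f g : E n → ℝ} {x : E n} (hf : ContDiffAt ℝ 2 f x)
    (hg : ContDiffAt ℝ 2 g x) (i j : Fin n) :
    D2x (fun y => f y - g y) x i j = D2x f x i j - D2x g x i j := by
  unfold D2x
  have : (fun y => fderiv ℝ (fun y => f y - g y) y (EuclideanSpace.single j 1)) =ᶠ[nhds x]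
      (fun y => fderiv ℝ f y (EuclideanSpace.single j 1)
        - fderiv ℝ g y (EuclideanSpace.single j 1)) := by
    filter_upwards [cd_two_eventually hf, cd_two_eventually hg] with y h1 h2
    rw [fderiv_fun_sub (cd_two_differentiable h1) (cd_two_differentiable h2)]
    rfl
  rw [this.fderiv_eq, fderiv_fun_sub ((cd_fderiv_apply hf _).differentiableAt (by norm_num))
    ((cd_fderiv_apply hg _).differentiableAt (by norm_num))]
  rfl

theorem D2x_sub_const {n : ℕ} (f : E n → ℝ) (c : ℝ) (x : E n) (i j : Fin n) :
    D2x (fun y => f y - c) x i j = D2x f x i j := by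
  unfold D2x
  simp only [fderiv_sub_const]

theorem D2x_continuousAt {n : ℕ} {f : E n → ℝ} {x : E n} (hf : ContDiffAt ℝ 2 f x)
    (i j : Fin n) : ContinuousAt (fun y => D2x f y i j) x := by
  unfold D2x
  have h := (cd_fderiv_apply hf (EuclideanSpace.single j 1))
  have h2 : ContDiffAt ℝ 0 (fderiv ℝ (fun x => fderiv ℝ f x (EuclideanSpace.single j 1))) x :=
    h.fderiv_right (by norm_num)
  exact (h2.continuousAt).clm_apply continuousAt_const

theorem D2x_comp {n : ℕ} {f : E n → ℝ} {x : E n} (hf : ContDiffAt ℝ 2 f x)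
    {p p' p'' : ℝ → ℝ} (h1 : ∀ s, HasDerivAt p (p' s) s) (h2 : ∀ s, HasDerivAt p' (p'' s) s)
    (i j : Fin n) :
    D2x (fun y => p (f y)) x i j =
      p'' (f x) * fderiv ℝ f x (EuclideanSpace.single i 1)
        * fderiv ℝ f x (EuclideanSpace.single j 1) + p' (f x) * D2x f x i j := by
  unfold D2x
  have : (fun y => fderiv ℝ (fun y => p (f y)) y (EuclideanSpace.single j 1)) =ᶠ[nhds x]
      (fun y => p' (f y) * fderiv ℝ f y (EuclideanSpace.single j 1)) := by
    filter_upwards [cd_two_eventually hf] with y hy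
    have := (h1 (f y)).comp_hasFDerivAt y (cd_two_differentiable hy).hasFDerivAt
    have e := this.fderiv
    simp only [Function.comp_def] at e
    rw [e]
    rfl
  rw [this.fderiv_eq]
  have ha := (h2 (f x)).comp_hasFDerivAt x (cd_two_differentiable hf).hasFDerivAt
  have hb := ((cd_fderiv_apply hf (EuclideanSpace.single j 1)).differentiableAt
    (by norm_num)).hasFDerivAt
  have := (ha.mul hb).fderiv
  simp only [Function.comp_def] at this
  erw [this]
  simp [smul_eq_mul]
  ring

open scoped MatrixOrder in
/-- Trace inequality. -/
theorem trace_ineq {n : ℕ} (A : Fin n → Fin n → ℝ)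
    (hA : ∀ ξ : Fin n → ℝ, 0 ≤ ∑ i, ∑ j, A i j * ξ i * ξ j)
    (H : Fin n → Fin n → ℝ) (hs : ∀ i j, H i j = H j i)
    (hH : ∀ ξ : Fin n → ℝ, ∑ i, ∑ j, H i j * ξ i * ξ j ≤ 0) :
    ∑ i, ∑ j, A i j * H i j ≤ 0 := by
  classical
  set S : Matrix (Fin n) (Fin n) ℝ := Matrix.of fun i j => - H i j with hS
  have hp : S.PosSemidef := by
    rw [Matrix.posSemidef_iff_dotProduct_mulVec]
    refine ⟨?_, ?_⟩
    · ext i j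
      simp [S, Matrix.conjTranspose_apply, hs i j]
    · intro x
      have := hH x
      simp only [dotProduct, Matrix.mulVec, S, Matrix.of_apply, Pi.star_apply, star_trivial,
        Finset.mul_sum]
      have e : ∑ i, ∑ j, x i * (-H i j * x j) = - ∑ i, ∑ j, H i j * x i * x j := by
        simp only [← Finset.sum_neg_distrib]
        refine Finset.sum_congr rfl fun i _ => Finset.sum_congr rfl fun j _ => by ring
      rw [e]; linarith
  obtain ⟨B, hB⟩ : ∃ B : Matrix (Fin n) (Fin n) ℝ, S = star B * B :=
    CStarAlgebra.nonneg_iff_eq_star_mul_self.mp hp.nonneg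
  have e : ∀ i j, - H i j = ∑ k, B k i * B k j := by
    intro i j
    have := congrFun (congrFun hB i) j
    simpa [S, Matrix.mul_apply, Matrix.star_apply] using this
  have e2 : ∑ i, ∑ j, A i j * H i j = - ∑ k, ∑ i, ∑ j, A i j * B k i * B k j := by
    have : ∀ i j, A i j * H i j = - ∑ k, A i j * B k i * B k j := by
      intro i j
      have := e i j
      rw [show H i j = - ∑ k, B k i * B k j by linarith, mul_neg, Finset.mul_sum]
      congr 1
      exact Finset.sum_congr rfl fun k _ => by ring
    simp only [this, Finset.sum_neg_distrib]
    congr 1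
    calc ∑ i, ∑ j, ∑ k, A i j * B k i * B k j
        = ∑ i, ∑ k, ∑ j, A i j * B k i * B k j :=
          Finset.sum_congr rfl fun i _ => Finset.sum_comm
      _ = _ := Finset.sum_comm
  rw [e2]
  have : 0 ≤ ∑ k, ∑ i, ∑ j, A i j * B k i * B k j :=
    Finset.sum_nonneg fun k _ => hA (fun i => B k i)
  linarith

theorem hess_at_max {n : ℕ} {f : E n → ℝ} {x : E n} (hf : ContDiffAt ℝ 2 f x)
    (hm : IsLocalMax f x) (A : Fin n → Fin n → ℝ)
    (hA : ∀ ξ : Fin n → ℝ, 0 ≤ ∑ i, ∑ j, A i j * ξ i * ξ j) :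
    ∑ i, ∑ j, A i j * D2x f x i j ≤ 0 := by
  have hd : DifferentiableAt ℝ (fderiv ℝ f) x :=
    (hf.fderiv_right (m := 1) (by norm_num)).differentiableAt (by norm_num)
  have hD : ∀ i j, D2x f x i j = fderiv ℝ (fderiv ℝ f) x (EuclideanSpace.single i 1)
      (EuclideanSpace.single j 1) := by
    intro i j
    unfold D2x
    rw [fderiv_clm_apply hd (by fun_prop)]
    simp
  have hsym := hf.isSymmSndFDerivAt (by simp)
  apply trace_ineq A hA
  · intro i j
    rw [hD, hD]
    exact hsym _ _
  · intro ξ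
    set v : E n := ∑ i, ξ i • EuclideanSpace.single i (1:ℝ) with hv
    have hvv : ∑ i, ∑ j, D2x f x i j * ξ i * ξ j = fderiv ℝ (fderiv ℝ f) x v v := by
      simp only [hv, map_sum, map_smul, sum_apply, smul_eq_mul,
        smul_apply, hD, Finset.mul_sum]
      rw [Finset.sum_comm]
      refine Finset.sum_congr rfl fun i _ => Finset.sum_congr rfl fun j _ => by ring
    rw [hvv]
    -- one-dimensional restriction
    set g : ℝ → ℝ := fun t => f (x + t • v) with hg
    have hline : ∀ t : ℝ, HasDerivAt (fun t : ℝ => x + t • v) v t := by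
      intro t
      simpa using ((hasDerivAt_id t).smul_const v).const_add x
    have hev : ∀ᶠ t in nhds (0:ℝ), ContDiffAt ℝ 2 f (x + t • v) := by
      have : ContinuousAt (fun t : ℝ => x + t • v) 0 := (hline 0).continuousAt
      refine this.eventually (p := fun y => ContDiffAt ℝ 2 f y) ?_
      simpa using cd_two_eventually hf
    have hg1 : deriv g =ᶠ[nhds 0] fun t => fderiv ℝ f (x + t • v) v := by
      filter_upwards [hev] with t ht
      exact ((cd_two_differentiable ht).hasFDerivAt.comp_hasDerivAt t (hline t)).deriv
    have hg2 : deriv (deriv g) 0 = fderiv ℝ (fderiv ℝ f) x v v := by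
      rw [hg1.deriv_eq]
      have h0 : HasFDerivAt (fderiv ℝ f) (fderiv ℝ (fderiv ℝ f) x) (x + (0:ℝ) • v) := by
        simpa using hd.hasFDerivAt
      have := h0.comp_hasDerivAt (0:ℝ) (hline 0)
      have h3 := this.clm_apply (hasDerivAt_const (0:ℝ) v)
      simpa using h3.deriv
    have hgc : ContinuousAt g 0 := by
      have h0 : HasFDerivAt f (fderiv ℝ f x) (x + (0:ℝ) • v) := by
        simpa using (cd_two_differentiable hf).hasFDerivAt
      exact (h0.comp_hasDerivAt (0:ℝ) (hline 0)).continuousAt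
    have hgm : IsLocalMax g 0 := by
      have : ContinuousAt (fun t : ℝ => x + t • v) 0 := (hline 0).continuousAt
      have h2 := this.eventually (p := fun y => f y ≤ f x) (by simpa [IsLocalMax, IsMaxFilter] using hm)
      filter_upwards [h2] with t ht
      simpa [hg] using ht
    by_contra hc
    push Not at hc
    have hmin := isLocalMin_of_deriv_deriv_pos (f := g) (x₀ := 0) (by rw [hg2]; exact hc)
      hgm.deriv_eq_zero hgc
    have hconst : g =ᶠ[nhds 0] fun _ => g 0 := by
      filter_upwards [hgm, hmin] with t h1 h2
      exact le_antisymm h1 h2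
    have : deriv (deriv g) 0 = 0 := by
      rw [hconst.deriv.deriv_eq]; simp
    rw [hg2] at this
    linarith


theorem integrable_of_support {n : ℕ} {U K : Set (E n)} (hK : IsCompact K) (hKU : K ⊆ U)
    {h : E n → ℝ} (hc : ∀ x ∈ U, ContinuousAt h x) (h0 : ∀ x ∉ K, h x = 0) :
    Integrable h volume := by
  have h1 : IntegrableOn h K volume :=
    ContinuousOn.integrableOn_compact hK
      (fun x hx => (hc x (hKU hx)).continuousWithinAt)
  refine (integrableOn_iff_integrable_of_support_subset ?_).mp h1
  intro x hx
  by_contra hxK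
  exact hx (h0 x hxK)

theorem fderiv_zero_off {n : ℕ} {K : Set (E n)} (hK : IsCompact K) {f : E n → ℝ}
    (h0 : ∀ x ∉ K, f x = 0) (v : E n) : ∀ x ∉ K, fderiv ℝ f x v = 0 := by
  intro x hx
  have : f =ᶠ[nhds x] fun _ => 0 := by
    filter_upwards [hK.isClosed.isOpen_compl.mem_nhds hx] with y hy
    exact h0 y hy
  rw [this.fderiv_eq]
  simp

theorem tsupport_sub_of_zero_off {n : ℕ} {K : Set (E n)} (hK : IsCompact K) {f : E n → ℝ}
    (h0 : ∀ x ∉ K, f x = 0) : tsupport f ⊆ K := by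
  refine closure_minimal ?_ hK.isClosed
  intro x hx
  by_contra hxK
  exact hx (h0 x hxK)

theorem ibp_two {n : ℕ} {U K : Set (E n)} (hK : IsCompact K) (hKU : K ⊆ U)
    {A f : E n → ℝ} (hA : ∀ x ∈ U, ContDiffAt ℝ 2 A x) (hf : ContDiff ℝ 2 f)
    (h0 : ∀ x ∉ K, f x = 0) (i j : Fin n) :
    ∫ x, A x * D2x f x i j = ∫ x, D2x A x j i * f x := by
  set ei : E n := EuclideanSpace.single i 1 with hei
  set ej : E n := EuclideanSpace.single j 1 with hej
  set g : E n → ℝ := fun x => fderiv ℝ f x ej with hg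
  set B : E n → ℝ := fun x => fderiv ℝ A x ei with hB
  have hg1 : ∀ x, ContDiffAt ℝ 1 g x := fun x => cd_fderiv_apply hf.contDiffAt ej
  have hB1 : ∀ x ∈ U, ContDiffAt ℝ 1 B x := fun x hx => cd_fderiv_apply (hA x hx) ei
  have hg0 : ∀ x ∉ K, g x = 0 := fderiv_zero_off hK h0 ej
  have hAc : ∀ x ∈ U, ContinuousAt A x := fun x hx => (hA x hx).continuousAt
  have hBc : ∀ x ∈ U, ContinuousAt B x := fun x hx => (hB1 x hx).continuousAt
  have hg' : ∀ x, ContinuousAt (fun x => fderiv ℝ g x ei) x :=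
    fun x => D2x_continuousAt hf.contDiffAt i j
  have hB' : ∀ x ∈ U, ContinuousAt (fun x => fderiv ℝ B x ej) x :=
    fun x hx => D2x_continuousAt (hA x hx) j i
  have e1 : ∫ x, A x * fderiv ℝ g x ei = - ∫ x, B x * g x := by
    apply integral_mul_fderiv_eq_neg_fderiv_mul_of_integrable
    · exact integrable_of_support hK hKU (fun x hx => (hBc x hx).mul (hg1 x).continuousAt)
        (fun x hx => by simp [hg0 x hx])
    · exact integrable_of_support hK hKU (fun x hx => (hAc x hx).mul (hg' x))
        (fun x hx => by simp [fderiv_zero_off hK hg0 ei x hx])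
    · exact integrable_of_support hK hKU (fun x hx => (hAc x hx).mul (hg1 x).continuousAt)
        (fun x hx => by simp [hg0 x hx])
    · intro x hx
      exact cd_two_differentiable (hA x (hKU (tsupport_sub_of_zero_off hK hg0 hx)))
    · intro x _
      exact (hg1 x).differentiableAt (by norm_num)
  have e2 : ∫ x, B x * fderiv ℝ f x ej = - ∫ x, fderiv ℝ B x ej * f x := by
    apply integral_mul_fderiv_eq_neg_fderiv_mul_of_integrable
    · exact integrable_of_support hK hKU (fun x hx => (hB' x hx).mul hf.continuous.continuousAt)
        (fun x hx => by simp [h0 x hx])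
    · exact integrable_of_support hK hKU (fun x hx => (hBc x hx).mul (hg1 x).continuousAt)
        (fun x hx => by simp [fderiv_zero_off hK h0 ej x hx])
    · exact integrable_of_support hK hKU (fun x hx => (hBc x hx).mul hf.continuous.continuousAt)
        (fun x hx => by simp [h0 x hx])
    · intro x hx
      exact (hB1 x (hKU (tsupport_sub_of_zero_off hK h0 hx))).differentiableAt (by norm_num)
    · intro x _
      exact cd_two_differentiable hf.contDiffAt
  change ∫ x, A x * fderiv ℝ g x ei = ∫ x, fderiv ℝ B x ej * f x
  rw [e1, e2, neg_neg]

/-- `Φ(s) = (s⁺)^4` and its derivatives. -/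
def Ph (s : ℝ) : ℝ := (max s 0) ^ 4
def Ph1 (s : ℝ) : ℝ := 4 * (max s 0) ^ 3
def Ph2 (s : ℝ) : ℝ := 12 * (max s 0) ^ 2

theorem hasDerivAt_pospow (k : ℕ) (hk : 1 ≤ k) (s : ℝ) :
    HasDerivAt (fun s : ℝ => (max s 0) ^ (k + 1)) (((k + 1 : ℕ) : ℝ) * (max s 0) ^ k) s := by
  rcases lt_trichotomy s 0 with hs | hs | hs
  · have : (fun s : ℝ => (max s 0) ^ (k + 1)) =ᶠ[nhds s] fun _ => (0:ℝ) := by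
      filter_upwards [Iio_mem_nhds hs] with y hy
      rw [max_eq_right (le_of_lt hy)]; simp
    rw [max_eq_right hs.le, zero_pow (by omega), mul_zero]
    exact (hasDerivAt_const s (0:ℝ)).congr_of_eventuallyEq this
  · subst hs
    rw [max_self, zero_pow (by omega), mul_zero]
    rw [hasDerivAt_iff_isLittleO_nhds_zero]
    have hb : (fun h : ℝ => (max (0 + h) 0) ^ (k + 1) - (max (0:ℝ) 0) ^ (k + 1) - h • (0:ℝ))
        =O[nhds 0] fun h : ℝ => h ^ (k+1) := by
      refine Asymptotics.IsBigO.of_bound 1 (Eventually.of_forall fun h => ?_)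
      simp only [zero_add, max_self, ne_eq, Nat.add_eq_zero_iff, one_ne_zero, and_false,
        not_false_eq_true, zero_pow, sub_zero, smul_eq_mul, mul_zero, Real.norm_eq_abs, one_mul,
        abs_pow]
      refine pow_le_pow_left₀ (abs_nonneg _) ?_ _
      rw [abs_of_nonneg (le_max_right h 0)]
      exact max_le (le_abs_self h) (abs_nonneg h)
    refine hb.trans_isLittleO ?_
    have := Asymptotics.isLittleO_pow_pow (𝕜 := ℝ) (m := 1) (n := k + 1) (by omega)
    simpa using this
  · have : (fun s : ℝ => (max s 0) ^ (k + 1)) =ᶠ[nhds s] fun y => y ^ (k+1) := by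
      filter_upwards [Ioi_mem_nhds hs] with y hy
      rw [max_eq_left (le_of_lt hy)]
    rw [max_eq_left hs.le]
    have h := hasDerivAt_pow (k+1) s
    simp only [Nat.add_sub_cancel] at h
    exact h.congr_of_eventuallyEq this

theorem hasDerivAt_Ph (s : ℝ) : HasDerivAt Ph (Ph1 s) s := by
  have := hasDerivAt_pospow 3 (by norm_num) s
  have e : (((3 + 1 : ℕ) : ℝ) * (max s 0) ^ 3) = Ph1 s := by unfold Ph1; norm_num
  rw [e] at this
  exact this

theorem hasDerivAt_Ph1 (s : ℝ) : HasDerivAt Ph1 (Ph2 s) s := by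
  have := (hasDerivAt_pospow 2 (by norm_num) s).const_mul 4
  have e : 4 * (((2 + 1 : ℕ) : ℝ) * (max s 0) ^ 2) = Ph2 s := by unfold Ph2; push_cast; ring
  rw [e] at this
  exact this

theorem contDiff_Ph : ContDiff ℝ 2 Ph := by
  have e1 : deriv Ph = Ph1 := funext fun s => (hasDerivAt_Ph s).deriv
  have e2 : deriv Ph1 = Ph2 := funext fun s => (hasDerivAt_Ph1 s).deriv
  have h1 : ContDiff ℝ 1 Ph1 := by
    rw [contDiff_one_iff_deriv]
    refine ⟨fun s => (hasDerivAt_Ph1 s).differentiableAt, ?_⟩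
    rw [e2]; unfold Ph2; fun_prop
  have : (2 : WithTop ℕ∞) = 1 + 1 := by norm_num
  rw [this, contDiff_succ_iff_deriv]
  refine ⟨fun s => (hasDerivAt_Ph s).differentiableAt, by simp, ?_⟩
  rw [e1]; exact h1

theorem Ph_nonneg (s : ℝ) : 0 ≤ Ph s := by unfold Ph; positivity
theorem Ph1_nonneg (s : ℝ) : 0 ≤ Ph1 s := by unfold Ph1; positivity
theorem Ph2_nonneg (s : ℝ) : 0 ≤ Ph2 s := by unfold Ph2; positivity
theorem Ph_of_nonpos {s : ℝ} (h : s ≤ 0) : Ph s = 0 := by simp [Ph, max_eq_right h]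
theorem Ph1_of_nonpos {s : ℝ} (h : s ≤ 0) : Ph1 s = 0 := by simp [Ph1, max_eq_right h]
theorem Ph_mono : Monotone Ph := by
  intro a b hab; unfold Ph; gcongr

/-- Energy inequality at a fixed time. -/
theorem energy_fixed {n : ℕ} {U K : Set (E n)} (hU : IsOpen U) (hK : IsCompact K) (hKU : K ⊆ U)
    {A : E n → Fin n → Fin n → ℝ} (hA : ∀ i j, ∀ x ∈ U, ContDiffAt ℝ 2 (fun x => A x i j) x)
    (hpos : ∀ x ∈ U, ∀ ξ : Fin n → ℝ, 0 ≤ ∑ i, ∑ j, A x i j * ξ i * ξ j)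
    {z : E n → ℝ} (hz : ∀ x ∈ U, ContDiffAt ℝ 2 z x) (hz0 : ∀ x ∈ U, x ∉ K → z x ≤ 0)
    {C : ℝ} (hC : ∀ x ∈ K, ∑ i, ∑ j, D2x (fun x => A x i j) x j i ≤ C) :
    ∫ x in K, Ph1 (z x) * ∑ i, ∑ j, A x i j * D2x z x i j ≤ C * ∫ x in K, Ph (z x) := by
  classical
  set f : E n → ℝ := fun x => if x ∈ U then Ph (z x) else 0 with hf
  have hfU : ∀ x ∈ U, f =ᶠ[nhds x] fun y => Ph (z y) := by
    intro x hx
    filter_upwards [hU.mem_nhds hx] with y hy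
    simp [hf, hy]
  have hf0 : ∀ x ∉ K, f x = 0 := by
    intro x hx
    by_cases hxU : x ∈ U
    · simp [hf, hxU, Ph_of_nonpos (hz0 x hxU hx)]
    · simp [hf, hxU]
  have hfc : ContDiff ℝ 2 f := by
    rw [contDiff_iff_contDiffAt]
    intro x
    by_cases hx : x ∈ K
    · have := (contDiff_Ph.contDiffAt (x := z x)).comp x (hz x (hKU hx))
      exact this.congr_of_eventuallyEq (hfU x (hKU hx))
    · have : f =ᶠ[nhds x] fun _ => 0 := by
        filter_upwards [hK.isClosed.isOpen_compl.mem_nhds hx] with y hy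
        exact hf0 y hy
      exact contDiffAt_const.congr_of_eventuallyEq this
  have hD0 : ∀ i j, ∀ x ∉ K, D2x f x i j = 0 := fun i j =>
    fderiv_zero_off hK (fderiv_zero_off hK hf0 _) _
  have hDf : ∀ i j, ∀ x ∈ U, D2x f x i j = Ph2 (z x) * fderiv ℝ z x (EuclideanSpace.single i 1)
        * fderiv ℝ z x (EuclideanSpace.single j 1) + Ph1 (z x) * D2x z x i j := by
    intro i j x hx
    rw [D2x_congr (hfU x hx), D2x_comp (hz x hx) hasDerivAt_Ph hasDerivAt_Ph1]
  have hI1 : ∀ i j, Integrable (fun x => A x i j * D2x f x i j) volume := fun i j =>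
    integrable_of_support hK hKU (fun x hx => (hA i j x hx).continuousAt.mul
      (D2x_continuousAt hfc.contDiffAt i j)) (fun x hx => by simp [hD0 i j x hx])
  have hI2 : ∀ i j, Integrable (fun x => D2x (fun x => A x i j) x j i * f x) volume := fun i j =>
    integrable_of_support hK hKU (fun x hx => (D2x_continuousAt (hA i j x hx) j i).mul
      hfc.continuous.continuousAt) (fun x hx => by simp [hf0 x hx])
  have hI3 : IntegrableOn (fun x => Ph1 (z x) * ∑ i, ∑ j, A x i j * D2x z x i j) K volume := by
    apply ContinuousOn.integrableOn_compact hK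
    intro x hx
    apply ContinuousAt.continuousWithinAt
    have hzx := hz x (hKU hx)
    have c1 : ContinuousAt (fun x => Ph1 (z x)) x := by
      unfold Ph1
      have := hzx.continuousAt
      fun_prop
    refine c1.mul (tendsto_finsetSum _ fun i _ => tendsto_finsetSum _ fun j _ => ?_)
    exact (hA i j x (hKU hx)).continuousAt.mul (D2x_continuousAt hzx i j)
  have step1 : ∫ x in K, Ph1 (z x) * ∑ i, ∑ j, A x i j * D2x z x i j
      ≤ ∫ x in K, ∑ i, ∑ j, A x i j * D2x f x i j := by
    apply setIntegral_mono_on hI3 _ hK.measurableSet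
    · intro x hx
      have hp := hpos x (hKU hx) (fun i => fderiv ℝ z x (EuclideanSpace.single i 1))
      have e : ∑ i, ∑ j, A x i j * D2x f x i j = Ph2 (z x) * (∑ i, ∑ j, A x i j *
          fderiv ℝ z x (EuclideanSpace.single i 1) * fderiv ℝ z x (EuclideanSpace.single j 1))
          + Ph1 (z x) * ∑ i, ∑ j, A x i j * D2x z x i j := by
        simp only [Finset.mul_sum, ← Finset.sum_add_distrib]
        refine Finset.sum_congr rfl fun i _ => Finset.sum_congr rfl fun j _ => ?_
        rw [hDf i j x (hKU hx)]; ring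
      rw [e]
      have := mul_nonneg (Ph2_nonneg (z x)) hp
      linarith
    · exact (integrable_finsetSum _ fun i _ => integrable_finsetSum _ fun j _ =>
        hI1 i j).integrableOn
  have step2 : ∫ x in K, ∑ i, ∑ j, A x i j * D2x f x i j
      = ∫ x, ∑ i, ∑ j, A x i j * D2x f x i j := by
    apply setIntegral_eq_integral_of_forall_compl_eq_zero
    intro x hx
    simp [hD0 _ _ x hx]
  have step3 : ∫ x, ∑ i, ∑ j, A x i j * D2x f x i j
      = ∫ x, ∑ i, ∑ j, D2x (fun x => A x i j) x j i * f x := by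
    rw [integral_finsetSum _ fun i _ => integrable_finsetSum _ fun j _ => hI1 i j,
      integral_finsetSum _ fun i _ => integrable_finsetSum _ fun j _ => hI2 i j]
    refine Finset.sum_congr rfl fun i _ => ?_
    rw [integral_finsetSum _ fun j _ => hI1 i j, integral_finsetSum _ fun j _ => hI2 i j]
    exact Finset.sum_congr rfl fun j _ => ibp_two hK hKU (hA i j) hfc hf0 i j
  have step4 : ∫ x, ∑ i, ∑ j, D2x (fun x => A x i j) x j i * f x
      = ∫ x in K, ∑ i, ∑ j, D2x (fun x => A x i j) x j i * f x := by
    symm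
    apply setIntegral_eq_integral_of_forall_compl_eq_zero
    intro x hx
    simp [hf0 x hx]
  have step5 : ∫ x in K, ∑ i, ∑ j, D2x (fun x => A x i j) x j i * f x
      ≤ ∫ x in K, C * Ph (z x) := by
    apply setIntegral_mono_on _ _ hK.measurableSet
    · intro x hx
      have : f x = Ph (z x) := by simp [hf, hKU hx]
      simp only [← Finset.sum_mul, this]
      exact mul_le_mul_of_nonneg_right (hC x hx) (Ph_nonneg _)
    · exact (integrable_finsetSum _ fun i _ => integrable_finsetSum _ fun j _ =>
        hI2 i j).integrableOn
    · apply ContinuousOn.integrableOn_compact hK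
      intro x hx
      apply ContinuousAt.continuousWithinAt
      exact continuousAt_const.mul
        (contDiff_Ph.continuous.continuousAt.comp (hz x (hKU hx)).continuousAt)
  rw [integral_const_mul] at step5
  linarith


theorem fderiv_slice {n : ℕ} {H : E n × ℝ → ℝ} {x : E n} {t : ℝ}
    (h : DifferentiableAt ℝ H (x, t)) (v : E n) :
    fderiv ℝ (fun y => H (y, t)) x v = fderiv ℝ H (x, t) (v, 0) := by
  have h1 : HasFDerivAt (fun y : E n => (y, t)) (ContinuousLinearMap.inl ℝ (E n) ℝ) x :=
    hasFDerivAt_prodMk_left x t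
  have := (h.hasFDerivAt.comp x h1).fderiv
  simp only [Function.comp_def] at this
  rw [this]
  simp

theorem cd_slice {n : ℕ} {G : E n × ℝ → ℝ} {k : WithTop ℕ∞} {x : E n} {t : ℝ}
    (h : ContDiffAt ℝ k G (x, t)) : ContDiffAt ℝ k (fun y => G (y, t)) x := by
  have h1 : ContDiffAt ℝ k (fun y : E n => (y, t)) x := contDiffAt_id.prodMk contDiffAt_const
  exact ContDiffAt.comp (f := fun y : E n => (y, t)) x h h1

theorem D2x_joint_continuous {n : ℕ} {G : E n × ℝ → ℝ} {V : Set (E n × ℝ)} (hV : IsOpen V)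
    (hG : ContDiffOn ℝ 2 G V) (i j : Fin n) :
    ContinuousOn (fun X : E n × ℝ => D2x (fun y => G (y, X.2)) X.1 i j) V := by
  have hG' : ∀ X ∈ V, ContDiffAt ℝ 2 G X := fun X hX => hG.contDiffAt (hV.mem_nhds hX)
  set H : E n × ℝ → ℝ := fun X => fderiv ℝ G X (EuclideanSpace.single j 1, 0) with hH
  have hH1 : ∀ X ∈ V, ContDiffAt ℝ 1 H X := fun X hX =>
    ((hG' X hX).fderiv_right (m := 1) (by norm_num)).clm_apply contDiffAt_const
  have e : ∀ X ∈ V, D2x (fun y => G (y, X.2)) X.1 i j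
      = fderiv ℝ H X (EuclideanSpace.single i 1, 0) := by
    rintro ⟨x, t⟩ hX
    have : (fun y => fderiv ℝ (fun y => G (y, t)) y (EuclideanSpace.single j 1)) =ᶠ[nhds x]
        fun y => H (y, t) := by
      have hc : ContinuousAt (fun y : E n => (y, t)) x := by fun_prop
      filter_upwards [hc.eventually (hV.mem_nhds hX)] with y hy
      exact fderiv_slice ((hG' _ hy).differentiableAt (by norm_num)) _
    unfold D2x
    simp only
    rw [this.fderiv_eq, fderiv_slice ((hH1 _ hX).differentiableAt (by norm_num))]
  refine ContinuousOn.congr (f := fun X => fderiv ℝ H X (EuclideanSpace.single i 1, 0)) ?_ e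
  intro X hX
  have h0 : ContDiffAt ℝ 0 (fderiv ℝ H) X := (hH1 X hX).fderiv_right (by norm_num)
  exact (h0.continuousAt.clm_apply continuousAt_const).continuousWithinAt

/-- Standing assumptions for the comparison principle. -/
structure Setup {n : ℕ} (a : E n × ℝ → Fin n → Fin n → ℝ) (U K : Set (E n)) (t₀ t₁ : ℝ)
    (u : E n × ℝ → ℝ) : Prop where
  hU : IsOpen U
  hK : IsCompact K
  hKU : K ⊆ U
  hpos : ∀ x ∈ U, ∀ t ∈ Ioo t₀ t₁, ∀ ξ : Fin n → ℝ, 0 ≤ ∑ i, ∑ j, a (x, t) i j * ξ i * ξ j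
  hsm : ∀ i j, ContDiffOn ℝ 2 (fun X => a X i j) (U ×ˢ Ioo t₀ t₁)
  hux : ∀ x ∈ U, ∀ t ∈ Ioo t₀ t₁, ContDiffAt ℝ 1 (fun y => u (y, t)) x
  hut : ∀ x ∈ U, ∀ t ∈ Ioo t₀ t₁, ContinuousAt (fun s => u (x, s)) t

/-- Strict subsolutions on `[α, β]` that are nonpositive off `K` and differ from `u` by a
continuous function. -/
structure SubOn {n : ℕ} (a : E n × ℝ → Fin n → Fin n → ℝ) (U K : Set (E n))
    (u z : E n × ℝ → ℝ) (α β : ℝ) : Prop where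
  cont : ContinuousOn (fun X => u X - z X) (K ×ˢ Icc α β)
  bdd : ∃ B, ∀ x ∈ U, ∀ t ∈ Icc α β, z (x, t) ≤ B
  cdx : ∀ x ∈ U, ∀ t ∈ Icc α β, ContDiffAt ℝ 2 (fun y => z (y, t)) x
  dt : ∀ x ∈ U, ∀ t ∈ Icc α β, DifferentiableAt ℝ (fun s => z (x, s)) t
  off : ∀ x ∈ U, x ∉ K → ∀ t ∈ Icc α β, z (x, t) ≤ 0
  sub : ∀ x ∈ K, ∀ t ∈ Icc α β, 0 < LVal a z (x, t)

/-- The comparison principle holds on the time set `I`. -/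
def Comp {n : ℕ} (a : E n × ℝ → Fin n → Fin n → ℝ) (U K : Set (E n))
    (u : E n × ℝ → ℝ) (I : Set ℝ) : Prop :=
  ∀ α ∈ I, ∀ β ∈ I, α < β → ∀ z, SubOn a U K u z α β → (∀ x ∈ U, z (x, α) ≤ 0) →
    ∀ x ∈ U, z (x, β) ≤ 0

section
variable {n : ℕ} {a : E n × ℝ → Fin n → Fin n → ℝ} {U K : Set (E n)} {t₀ t₁ : ℝ}
  {u z : E n × ℝ → ℝ} {α β : ℝ}

theorem SubOn.mono (h : SubOn a U K u z α β) {α' β' : ℝ} (h1 : α ≤ α') (h2 : β' ≤ β) :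
    SubOn a U K u z α' β' := by
  have hs : Icc α' β' ⊆ Icc α β := Icc_subset_Icc h1 h2
  obtain ⟨B, hB⟩ := h.bdd
  exact ⟨h.cont.mono (prod_mono_right hs), ⟨B, fun x hx t ht => hB x hx t (hs ht)⟩,
    fun x hx t ht => h.cdx x hx t (hs ht), fun x hx t ht => h.dt x hx t (hs ht),
    fun x hx hk t ht => h.off x hx hk t (hs ht), fun x hx t ht => h.sub x hx t (hs ht)⟩

/-- Subtracting `g(x) + C (t - τ)`. -/
theorem SubOn.sub_fun (h : SubOn a U K u z α β) (hKU : K ⊆ U) {g : E n → ℝ} {C : ℝ}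
    (hg : ∀ x ∈ U, ContDiffAt ℝ 2 g x) (hg0 : ∀ x ∈ U, 0 ≤ g x) (hC : 0 ≤ C)
    (hL : ∀ x ∈ K, ∀ t ∈ Icc α β, ∑ i, ∑ j, a (x, t) i j * D2x g x i j ≤ C) :
    SubOn a U K u (fun X => z X - (g X.1 + C * (X.2 - α))) α β := by
  obtain ⟨B, hB⟩ := h.bdd
  have hn : ∀ x ∈ U, ∀ t ∈ Icc α β, 0 ≤ g x + C * (t - α) := fun x hx t ht =>
    add_nonneg (hg0 x hx) (mul_nonneg hC (by linarith [ht.1]))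
  refine ⟨?_, ⟨B, fun x hx t ht => ?_⟩, fun x hx t ht => ?_, fun x hx t ht => ?_,
    fun x hx hk t ht => ?_, fun x hx t ht => ?_⟩
  · have e : (fun X : E n × ℝ => u X - (z X - (g X.1 + C * (X.2 - α)))) =
        fun X => (u X - z X) + (g X.1 + C * (X.2 - α)) := by
      funext X; ring
    rw [e]
    refine h.cont.add ?_
    intro X hX
    have : ContinuousAt g X.1 := (hg _ (hKU hX.1)).continuousAt
    apply ContinuousAt.continuousWithinAt
    have h2 : ContinuousAt (fun X : E n × ℝ => g X.1) X :=
      ContinuousAt.comp (f := Prod.fst) this continuousAt_fst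
    exact h2.add (by fun_prop)
  · have := hB x hx t ht
    have := hn x hx t ht
    simp only; linarith
  · have h7 : ContDiffAt ℝ 2 (fun y => g y + C * (t - α)) x := (hg x hx).add contDiffAt_const
    exact (h.cdx x hx t ht).sub h7
  · have h7 : DifferentiableAt ℝ (fun s : ℝ => g x + C * (s - α)) t := by fun_prop
    exact (h.dt x hx t ht).sub h7
  · have := h.off x hx hk t ht
    have := hn x hx t ht
    simp only; linarith
  · have h1 := h.sub x hx t ht
    have h2 := hL x hx t ht
    have hxU := hKU hx
    unfold LVal at h1 ⊢
    have e1 : ∀ i j, D2 (fun X => z X - (g X.1 + C * (X.2 - α))) (x, t) i j =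
        D2 z (x, t) i j - D2x g x i j := by
      intro i j
      rw [D2_eq_D2x, D2_eq_D2x]
      simp only
      rw [D2x_sub (h.cdx x hxU t ht) ((hg x hxU).add contDiffAt_const)]
      congr 1
      have : (fun y => g y + C * (t - α)) = fun y => g y - (-(C * (t - α))) := by
        funext y; ring
      rw [this, D2x_sub_const]
    have e2 : Dt (fun X => z X - (g X.1 + C * (X.2 - α))) (x, t) = Dt z (x, t) - C := by
      unfold Dt
      simp only
      have h3 : HasDerivAt (fun s : ℝ => g x + C * (s - α)) C t := by
        simpa using (((hasDerivAt_id t).sub_const α).const_mul C).const_add (g x)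
      exact ((h.dt x hxU t ht).hasDerivAt.sub h3).deriv
    simp only [e1, e2]
    simp only [mul_sub, Finset.sum_sub_distrib]
    linarith

theorem SubOn.sub_const (h : SubOn a U K u z α β) (hKU : K ⊆ U) {c : ℝ} (hc : 0 ≤ c) :
    SubOn a U K u (fun X => z X - c) α β := by
  have := h.sub_fun hKU (g := fun _ => c) (C := 0) (fun _ _ => contDiffAt_const)
    (fun _ _ => hc) le_rfl (fun x _ t _ => by simp [D2x])
  simpa using this

/-- Backward propagation. -/
theorem back_step (S : Setup a U K t₀ t₁ u) (h : SubOn a U K u z α β) (hα : t₀ < α)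
    (hβ : β < t₁) {t : ℝ} (ht : t ∈ Icc α β) {c : ℝ} (hc : 0 < c) (hx : ∃ x ∈ U, c ≤ z (x, t)) :
    ∃ x ∈ U, ∀ᶠ s in nhdsWithin t (Iio t), c ≤ z (x, s) := by
  obtain ⟨x₁, hx₁, hcx⟩ := hx
  have hx₁K : x₁ ∈ K := by
    by_contra hk
    have := h.off x₁ hx₁ hk t ht
    linarith
  have hcont : ContinuousOn (fun y => z (y, t)) K := fun y hy =>
    (h.cdx y (S.hKU hy) t ht).continuousAt.continuousWithinAt
  obtain ⟨x, hxK, hmax⟩ := S.hK.exists_isMaxOn ⟨x₁, hx₁K⟩ hcont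
  have hxU := S.hKU hxK
  have hzx : c ≤ z (x, t) := hcx.trans (hmax hx₁K)
  have hloc : IsLocalMax (fun y => z (y, t)) x := by
    filter_upwards [S.hU.mem_nhds hxU] with y hy
    by_cases hyK : y ∈ K
    · exact hmax hyK
    · have := h.off y hy hyK t ht
      show z (y, t) ≤ z (x, t)
      linarith
  have htt : t ∈ Ioo t₀ t₁ := ⟨by linarith [ht.1], by linarith [ht.2]⟩
  have hH := hess_at_max (h.cdx x hxU t ht) hloc (a (x, t)) (S.hpos x hxU t htt)
  have hL := h.sub x hxK t ht
  have hd : Dt z (x, t) < 0 := by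
    unfold LVal at hL
    simp only [D2_eq_D2x] at hL
    linarith
  have hdd : HasDerivAt (fun s => z (x, s)) (Dt z (x, t)) t := (h.dt x hxU t ht).hasDerivAt
  refine ⟨x, hxU, ?_⟩
  have hs := hdd.tendsto_slope
  have h2 : ∀ᶠ s in nhdsWithin t (Iio t), slope (fun s => z (x, s)) t s < 0 :=
    (hs.mono_left (nhdsWithin_mono _ (fun y hy => ne_of_lt hy))).eventually (Iio_mem_nhds hd)
  filter_upwards [h2, self_mem_nhdsWithin] with s h3 h4
  rw [slope_def_field] at h3
  have h5 : s - t < 0 := sub_neg.mpr h4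
  have h6 : 0 < z (x, s) - z (x, t) := by
    by_contra hcon
    push Not at hcon
    have := div_nonneg_of_nonpos hcon h5.le
    linarith
  linarith
end


/-- Smooth regularisation of `max s 0`. -/
def Pt (η s : ℝ) : ℝ := η + (s - η) * Real.smoothTransition (s / η)

theorem contDiff_Pt (η : ℝ) : ContDiff ℝ 2 (Pt η) := by
  unfold Pt
  have : ContDiff ℝ 2 Real.smoothTransition := Real.smoothTransition.contDiff
  fun_prop

theorem le_Pt {η : ℝ} (hη : 0 < η) (s : ℝ) : s ≤ Pt η s := by
  unfold Pt
  have h0 := Real.smoothTransition.nonneg (s / η)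
  have h1 := Real.smoothTransition.le_one (s / η)
  rcases le_total η s with h | h
  · rw [Real.smoothTransition.one_of_one_le ((one_le_div hη).2 h)]; linarith
  · nlinarith

theorem Pt_nonneg {η : ℝ} (hη : 0 < η) (s : ℝ) : 0 ≤ Pt η s := by
  rcases le_total 0 s with h | h
  · exact h.trans (le_Pt hη s)
  · unfold Pt
    rw [Real.smoothTransition.zero_of_nonpos (div_nonpos_of_nonpos_of_nonneg h hη.le)]; linarith

theorem Pt_sub_le {η : ℝ} (hη : 0 < η) (s : ℝ) : Pt η s - η ≤ max (s - η) 0 := by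
  unfold Pt
  have h0 := Real.smoothTransition.nonneg (s / η)
  have h1 := Real.smoothTransition.le_one (s / η)
  rcases le_total η s with h | h
  · refine le_trans ?_ (le_max_left _ _)
    nlinarith
  · refine le_trans ?_ (le_max_right _ _)
    nlinarith

theorem Ph_quot {η w s d B : ℝ} (hη : 0 < η) (hd : 0 ≤ d) (hw : w ≤ Pt η s + d)
    (hB : max (s - η) 0 ≤ B) : Ph (w - η) - Ph (s - η) ≤ 4 * (B + d) ^ 3 * d := by
  have h1 := Pt_sub_le hη s
  unfold Ph
  set M := max (s - η) 0 with hM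
  have hM0 : 0 ≤ M := le_max_right _ _
  have h2 : max (w - η) 0 ≤ M + d := max_le (by linarith) (by linarith)
  have h3 : (max (w - η) 0) ^ 4 ≤ (M + d) ^ 4 := by gcongr
  have h4 : (M + d) ^ 3 ≤ (B + d) ^ 3 := by gcongr
  have h5 : (M + d) ^ 4 - M ^ 4 ≤ 4 * (M + d) ^ 3 * d := by
    have : 4 * (M + d) ^ 3 * d - ((M + d) ^ 4 - M ^ 4) = 6 * M^2*d^2 + 8 * M * d^3 + 3 * d^4 := by
      ring
    have : 0 ≤ 6 * M^2*d^2 + 8 * M * d^3 + 3 * d^4 := by positivity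
    linarith
  have h6 : 4 * (M + d) ^ 3 * d ≤ 4 * (B + d) ^ 3 * d := by gcongr
  linarith

section
variable {n : ℕ} {a : E n × ℝ → Fin n → Fin n → ℝ} {U K : Set (E n)} {t₀ t₁ : ℝ}
  {u z : E n × ℝ → ℝ} {α β : ℝ}

theorem coeff_contDiffAt (S : Setup a U K t₀ t₁ u) {x : E n} (hx : x ∈ U) {t : ℝ}
    (ht : t ∈ Ioo t₀ t₁) (i j : Fin n) : ContDiffAt ℝ 2 (fun X => a X i j) (x, t) :=
  (S.hsm i j).contDiffAt ((S.hU.prod isOpen_Ioo).mem_nhds ⟨hx, ht⟩)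

/-- Uniform bound of `∑ a D²g` on a compact time interval. -/
theorem exists_bound_L (S : Setup a U K t₀ t₁ u) (hα : t₀ < α) (hβ : β < t₁) {g : E n → ℝ}
    (hg : ∀ x ∈ U, ContDiffAt ℝ 2 g x) :
    ∃ C, 0 ≤ C ∧ ∀ x ∈ K, ∀ t ∈ Icc α β, ∑ i, ∑ j, a (x, t) i j * D2x g x i j ≤ C := by
  have hc : ContinuousOn (fun X : E n × ℝ => ∑ i, ∑ j, a X i j * D2x g X.1 i j)
      (K ×ˢ Icc α β) := by
    refine continuousOn_finsetSum _ fun i _ => continuousOn_finsetSum _ fun j _ => ?_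
    intro X hX
    have hXU := S.hKU hX.1
    have hXt : X.2 ∈ Ioo t₀ t₁ := ⟨by linarith [hX.2.1], by linarith [hX.2.2]⟩
    have h1 : ContinuousAt (fun X => a X i j) X := (coeff_contDiffAt S hXU hXt i j).continuousAt
    have h2 : ContinuousAt (fun X : E n × ℝ => D2x g X.1 i j) X :=
      ContinuousAt.comp (f := Prod.fst) (D2x_continuousAt (hg _ hXU) i j) continuousAt_fst
    exact (h1.mul h2).continuousWithinAt
  obtain ⟨C, hC⟩ := (S.hK.prod isCompact_Icc).bddAbove_image hc
  refine ⟨max C 0, le_max_right _ _, fun x hx t ht => le_trans ?_ (le_max_left _ _)⟩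
  exact hC ⟨(x, t), ⟨hx, ht⟩, rfl⟩

theorem exists_bound_div (S : Setup a U K t₀ t₁ u) (hα : t₀ < α) (hβ : β < t₁) :
    ∃ C, 0 ≤ C ∧ ∀ t ∈ Icc α β, ∀ x ∈ K,
      ∑ i, ∑ j, D2x (fun x => a (x, t) i j) x j i ≤ C := by
  have hc : ContinuousOn (fun X : E n × ℝ => ∑ i, ∑ j, D2x (fun x => a (x, X.2) i j) X.1 j i)
      (K ×ˢ Icc α β) := by
    refine continuousOn_finsetSum _ fun i _ => continuousOn_finsetSum _ fun j _ => ?_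
    refine (D2x_joint_continuous (S.hU.prod isOpen_Ioo) (S.hsm i j) j i).mono ?_
    rintro ⟨x, t⟩ ⟨hx, ht⟩
    exact ⟨S.hKU hx, by linarith [ht.1], by linarith [ht.2]⟩
  obtain ⟨C, hC⟩ := (S.hK.prod isCompact_Icc).bddAbove_image hc
  refine ⟨max C 0, le_max_right _ _, fun t ht x hx => le_trans ?_ (le_max_left _ _)⟩
  exact hC ⟨(x, t), ⟨hx, ht⟩, rfl⟩

theorem Ph_continuous : Continuous Ph := contDiff_Ph.continuous
theorem Ph1_continuous : Continuous Ph1 := by unfold Ph1; fun_prop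

theorem zslice_cont (S : Setup a U K t₀ t₁ u) (h : SubOn a U K u z α β) {t : ℝ}
    (ht : t ∈ Icc α β) : ContinuousOn (fun x => z (x, t)) K := fun x hx =>
  (h.cdx x (S.hKU hx) t ht).continuousAt.continuousWithinAt

theorem J_contOn (S : Setup a U K t₀ t₁ u) (h : SubOn a U K u z α β) (η : ℝ) :
    ContinuousOn (fun t => ∫ x in K, Ph (z (x, t) - η)) (Icc α β) := by
  obtain ⟨B, hB⟩ := h.bdd
  have hfin : IsFiniteMeasure (volume.restrict K) := ⟨by
    rw [Measure.restrict_apply_univ]; exact S.hK.measure_lt_top⟩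
  refine continuousOn_of_dominated (bound := fun _ => Ph (B - η)) ?_ ?_ (integrable_const _) ?_
  · intro t ht
    refine ContinuousOn.aestronglyMeasurable ?_ S.hK.measurableSet
    exact Ph_continuous.comp_continuousOn ((zslice_cont S h ht).sub continuousOn_const)
  · intro t ht
    refine (ae_restrict_iff' S.hK.measurableSet).2 (Eventually.of_forall fun x hx => ?_)
    rw [Real.norm_of_nonneg (Ph_nonneg _)]
    exact Ph_mono (by linarith [hB x (S.hKU hx) t ht])
  · refine (ae_restrict_iff' S.hK.measurableSet).2 (Eventually.of_forall fun x hx => ?_)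
    intro t ht
    exact Ph_continuous.continuousAt.comp_continuousWithinAt
      (((h.dt x (S.hKU hx) t ht).continuousAt.sub continuousAt_const).continuousWithinAt)

theorem J_dini (S : Setup a U K t₀ t₁ u) (h : SubOn a U K u z α β) (hα : t₀ < α)
    (hβ : β < t₁) {γ : ℝ} (hγ : β < γ) (hC : Comp a U K u (Ioo α γ)) {η C : ℝ} (hη : 0 < η)
    (hdiv : ∀ t ∈ Icc α β, ∀ x ∈ K, ∑ i, ∑ j, D2x (fun x => a (x, t) i j) x j i ≤ C)
    {τ : ℝ} (hτ : τ ∈ Ioo α β) {r : ℝ} (hr : C * (∫ x in K, Ph (z (x, τ) - η)) < r) :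
    ∀ᶠ s in nhdsWithin τ (Ioi τ),
      (s - τ)⁻¹ * ((∫ x in K, Ph (z (x, s) - η)) - ∫ x in K, Ph (z (x, τ) - η)) < r := by
  have hfin : IsFiniteMeasure (volume.restrict K) := ⟨by
    rw [Measure.restrict_apply_univ]; exact S.hK.measure_lt_top⟩
  have hτ' : τ ∈ Icc α β := ⟨hτ.1.le, hτ.2.le⟩
  have hτt : τ ∈ Ioo t₀ t₁ := ⟨hα.trans hτ.1, hτ.2.trans hβ⟩
  obtain ⟨B, hB⟩ := h.bdd
  set g : E n → ℝ := fun x => Pt η (z (x, τ)) with hgdef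
  have hg : ∀ x ∈ U, ContDiffAt ℝ 2 g x := fun x hx =>
    (contDiff_Pt η).contDiffAt.comp x (h.cdx x hx τ hτ')
  obtain ⟨C1, hC1, hL⟩ := exists_bound_L S hα hβ hg
  set B' : ℝ := max (B - η) 0 with hB'
  set Cd : ℝ := 4 * (B' + C1 * (β - τ)) ^ 3 * C1 with hCd
  have hB'0 : 0 ≤ B' := le_max_right _ _
  have hβτ : 0 < β - τ := sub_pos.2 hτ.2
  -- pointwise upper bound for later times
  have hup : ∀ s ∈ Ioc τ β, ∀ x ∈ U, z (x, s) ≤ Pt η (z (x, τ)) + C1 * (s - τ) := by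
    intro s hs x hx
    have h1 := (h.mono hτ.1.le hs.2).sub_fun S.hKU hg (fun x _ => Pt_nonneg hη _) hC1
      (fun x hx t ht => hL x hx t ⟨hτ.1.le.trans ht.1, ht.2.trans hs.2⟩)
    have h2 := hC τ ⟨hτ.1, hτ.2.trans hγ⟩ s ⟨hτ.1.trans hs.1, hs.2.trans_lt hγ⟩ hs.1 _ h1
      (fun x hx => by
        have := le_Pt hη (z (x, τ))
        simp only [hgdef, sub_self, mul_zero]; linarith) x hx
    simp only [hgdef] at h2
    linarith
  set Q : ℝ → E n → ℝ := fun s x => (s - τ)⁻¹ * (Ph (z (x, s) - η) - Ph (z (x, τ) - η)) with hQ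
  have hQb : ∀ s ∈ Ioc τ β, ∀ x ∈ U, Q s x ≤ Cd := by
    intro s hs x hx
    have h0 : 0 < s - τ := sub_pos.2 hs.1
    have h1 := Ph_quot hη (mul_nonneg hC1 h0.le) (hup s hs x hx) (B := B')
      (max_le_max (by linarith [hB x hx τ hτ']) le_rfl)
    have h2 : 4 * (B' + C1 * (s - τ)) ^ 3 * (C1 * (s - τ)) ≤ Cd * (s - τ) := by
      rw [hCd, ← mul_assoc]
      have : C1 * (s - τ) ≤ C1 * (β - τ) := mul_le_mul_of_nonneg_left (by linarith [hs.2]) hC1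
      gcongr
    rw [hQ]
    simp only
    rw [inv_mul_le_iff₀ h0]
    linarith
  set ℓ : E n → ℝ := fun x => Ph1 (z (x, τ) - η) * ∑ i, ∑ j, a (x, τ) i j *
    D2x (fun y => z (y, τ)) x i j with hℓ
  have hℓc : ContinuousOn ℓ K := by
    refine ContinuousOn.mul (Ph1_continuous.comp_continuousOn
      ((zslice_cont S h hτ').sub continuousOn_const)) ?_
    refine continuousOn_finsetSum _ fun i _ => continuousOn_finsetSum _ fun j _ => ?_
    intro x hx
    have h1 := (cd_slice (coeff_contDiffAt S (S.hKU hx) hτt i j)).continuousAt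
    exact (h1.mul (D2x_continuousAt (h.cdx x (S.hKU hx) τ hτ') i j)).continuousWithinAt
  obtain ⟨M, hM⟩ := S.hK.exists_bound_of_continuousOn hℓc
  have hPc : ∀ s ∈ Icc α β, ContinuousOn (fun x => Ph (z (x, s) - η)) K := fun s hs =>
    Ph_continuous.comp_continuousOn ((zslice_cont S h hs).sub continuousOn_const)
  have hQc : ∀ s ∈ Icc α β, ContinuousOn (Q s) K := fun s hs =>
    continuousOn_const.mul ((hPc s hs).sub (hPc τ hτ'))
  have hev : ∀ᶠ s in nhdsWithin τ (Ioi τ), s ∈ Ioc τ β := by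
    filter_upwards [self_mem_nhdsWithin, mem_nhdsWithin_of_mem_nhds (Iio_mem_nhds hτ.2)]
      with s h1 h2 using ⟨h1, le_of_lt h2⟩
  have hIoc : ∀ s ∈ Ioc τ β, s ∈ Icc α β := fun s hs => ⟨hτ.1.le.trans hs.1.le, hs.2⟩
  have hlim : Tendsto (fun s => ∫ x in K, max (Q s x) (ℓ x)) (nhdsWithin τ (Ioi τ))
      (nhds (∫ x in K, ℓ x)) := by
    refine tendsto_integral_filter_of_dominated_convergence (fun _ => max |Cd| M) ?_ ?_
      (integrable_const _) ?_
    · filter_upwards [hev] with s hs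
      exact ((hQc s (hIoc s hs)).sup hℓc).aestronglyMeasurable S.hK.measurableSet
    · filter_upwards [hev] with s hs
      refine (ae_restrict_iff' S.hK.measurableSet).2 (Eventually.of_forall fun x hx => ?_)
      have h1 := hQb s hs x (S.hKU hx)
      have h2 := hM x hx
      rw [Real.norm_eq_abs] at h2 ⊢
      have h3 := abs_le.1 h2
      rw [abs_le]
      constructor
      · have := le_max_right (Q s x) (ℓ x)
        have := le_max_right |Cd| M
        linarith
      · refine max_le ?_ ?_
        · exact h1.trans ((le_abs_self _).trans (le_max_left _ _))
        · exact h3.2.trans (le_max_right _ _)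
    · refine (ae_restrict_iff' S.hK.measurableSet).2 (Eventually.of_forall fun x hx => ?_)
      have hd : HasDerivAt (fun s => z (x, s)) (Dt z (x, τ)) τ :=
        (h.dt x (S.hKU hx) τ hτ').hasDerivAt
      have hd2 : HasDerivAt (fun s => Ph (z (x, s) - η))
          (Ph1 (z (x, τ) - η) * Dt z (x, τ)) τ :=
        HasDerivAt.comp (h₂ := Ph) (h := fun s => z (x, s) - η) τ
          (hasDerivAt_Ph (z (x, τ) - η)) (hd.sub_const η)
      have h1 := hd2.tendsto_slope
      have h2 : Tendsto (fun s => Q s x) (nhdsWithin τ (Ioi τ))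
          (nhds (Ph1 (z (x, τ) - η) * Dt z (x, τ))) := by
        refine (h1.mono_left (nhdsWithin_mono _ (fun y hy => ne_of_gt hy))).congr fun s => ?_
        simp only [hQ, slope, vsub_eq_sub, smul_eq_mul]
      have h3 := h2.max (tendsto_const_nhds (x := ℓ x))
      have h4 : Ph1 (z (x, τ) - η) * Dt z (x, τ) ≤ ℓ x := by
        have := h.sub x hx τ hτ'
        unfold LVal at this
        simp only [D2_eq_D2x] at this
        exact mul_le_mul_of_nonneg_left (by linarith) (Ph1_nonneg _)
      rwa [max_eq_right h4] at h3
  have hen : ∫ x in K, ℓ x ≤ C * ∫ x in K, Ph (z (x, τ) - η) := by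
    have := energy_fixed S.hU S.hK S.hKU (A := fun x => a (x, τ))
      (fun i j x hx => cd_slice (coeff_contDiffAt S hx hτt i j))
      (fun x hx => S.hpos x hx τ hτt) (z := fun x => z (x, τ) - η)
      (fun x hx => (h.cdx x hx τ hτ').sub contDiffAt_const)
      (fun x hx hk => by linarith [h.off x hx hk τ hτ']) (hdiv τ hτ')
    simpa only [D2x_sub_const] using this
  have hlt := hlim.eventually (Iio_mem_nhds (hen.trans_lt hr))
  filter_upwards [hlt, hev] with s h1 h2
  refine lt_of_le_of_lt ?_ h1
  have i1 := (hPc s (hIoc s h2)).integrableOn_compact S.hK (μ := volume)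
  have i2 := (hPc τ hτ').integrableOn_compact S.hK (μ := volume)
  rw [← integral_sub i1 i2, ← integral_const_mul]
  refine integral_mono ((i1.sub i2).const_mul _) ?_ (fun x => le_max_left _ _)
  exact ((hQc s (hIoc s h2)).sup hℓc).integrableOn_compact S.hK

theorem no_jump (S : Setup a U K t₀ t₁ u) (h : SubOn a U K u z α β) (hα : t₀ < α)
    (hαβ : α < β) {γ : ℝ} (hβγ : β < γ) (hγ : γ ≤ t₁) (hC : Comp a U K u (Ioo α γ))
    (h0 : ∀ x ∈ U, z (x, α) ≤ 0) : ∀ x ∈ U, z (x, β) ≤ 0 := by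
  have hβ : β < t₁ := hβγ.trans_le hγ
  obtain ⟨C, hC0, hdiv⟩ := exists_bound_div S hα hβ
  have key : ∀ η > 0, ∀ x ∈ U, z (x, β) ≤ η := by
    intro η hη
    set J : ℝ → ℝ := fun t => ∫ x in K, Ph (z (x, t) - η) with hJ
    have hJc : ContinuousOn J (Icc α β) := J_contOn S h η
    have hJα : J α = 0 := by
      rw [hJ]
      refine setIntegral_eq_zero_of_forall_eq_zero fun x hx => ?_
      exact Ph_of_nonpos (by linarith [h0 x (S.hKU hx)])
    have hg : ∀ α' ∈ Ioo α β, J β ≤ J α' * Real.exp (C * (β - α')) := by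
      intro α' hα'
      have := le_gronwallBound_of_liminf_deriv_right_le (f := J) (f' := fun t => C * J t)
        (δ := J α') (K := C) (ε := 0) (a := α') (b := β)
        (hJc.mono (Icc_subset_Icc hα'.1.le le_rfl))
        (fun t ht r hr => (J_dini S h hα hβ hβγ hC hη hdiv
          ⟨hα'.1.trans_le ht.1, ht.2⟩ hr).frequently) le_rfl (fun t _ => by simp) β
          ⟨hα'.2.le, le_rfl⟩
      rwa [gronwallBound_ε0] at this
    have hJβ : J β ≤ 0 := by
      have h1 : Tendsto (fun α' => J α' * Real.exp (C * (β - α'))) (nhdsWithin α (Ioi α))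
          (nhds (J α * Real.exp (C * (β - α)))) := by
        refine Tendsto.mul ?_ ?_
        · have := hJc α ⟨le_rfl, hαβ.le⟩
          refine this.mono_left ?_
          rw [← nhdsWithin_Ioc_eq_nhdsGT hαβ]
          exact nhdsWithin_mono _ Ioc_subset_Icc_self
        · exact ((by fun_prop : Continuous fun α' => Real.exp (C * (β - α'))).tendsto
            α).mono_left nhdsWithin_le_nhds
      rw [hJα, zero_mul] at h1
      refine ge_of_tendsto h1 ?_
      rw [← nhdsWithin_Ioo_eq_nhdsGT hαβ]
      filter_upwards [self_mem_nhdsWithin] with α' hα' using hg α' hα'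
    intro x hx
    by_contra hcon
    push Not at hcon
    have hβI : β ∈ Icc α β := ⟨hαβ.le, le_rfl⟩
    have hPc : ContinuousOn (fun x => Ph (z (x, β) - η)) K :=
      Ph_continuous.comp_continuousOn ((zslice_cont S h hβI).sub continuousOn_const)
    have hz : J β = 0 := le_antisymm hJβ (integral_nonneg fun x => Ph_nonneg _)
    have hae := (integral_eq_zero_iff_of_nonneg (fun x => Ph_nonneg _)
      (hPc.integrableOn_compact S.hK)).1 hz
    have hae2 := (ae_restrict_iff' S.hK.measurableSet).1 hae
    set W : Set (E n) := U ∩ (fun y => z (y, β)) ⁻¹' (Ioi η) with hW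
    have hWo : IsOpen W := by
      refine ContinuousOn.isOpen_inter_preimage ?_ S.hU isOpen_Ioi
      exact fun y hy => (h.cdx y hy β hβI).continuousAt.continuousWithinAt
    have hWp : 0 < volume W := hWo.measure_pos volume ⟨x, hx, hcon⟩
    have hW0 : volume W = 0 := by
      refine measure_mono_null ?_ hae2
      intro y hy hyc
      have hyK : y ∈ K := by
        by_contra hk
        have := h.off y hy.1 hk β hβI
        have : η < z (y, β) := hy.2
        linarith
      have h1 := hyc hyK
      have h2 : 0 < z (y, β) - η := sub_pos.2 hy.2
      simp only [Ph, max_eq_left h2.le, Pi.zero_apply] at h1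
      have : 0 < (z (y, β) - η) ^ 4 := by positivity
      linarith
    rw [hW0] at hWp
    exact lt_irrefl _ hWp
  intro x hx
  exact le_of_forall_pos_le_add fun η hη => by simpa using key η hη x hx
end


section
variable {n : ℕ} {a : E n × ℝ → Fin n → Fin n → ℝ} {U K : Set (E n)} {t₀ t₁ : ℝ}
  {u z : E n × ℝ → ℝ} {α β : ℝ}

/-- Local validity of the comparison principle near the time `t`. -/
def LC {n : ℕ} (a : E n × ℝ → Fin n → Fin n → ℝ) (U K : Set (E n))
    (u : E n × ℝ → ℝ) (t : ℝ) : Prop :=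
  ∃ δ > 0, Comp a U K u (Ioo (t - δ) (t + δ))

theorem Comp.mono {I I' : Set ℝ} (h : Comp a U K u I) (hI : I' ⊆ I) : Comp a U K u I' :=
  fun α hα β hβ => h α (hI hα) β (hI hβ)

theorem comp_of_local {p q : ℝ} (h : ∀ t ∈ Ioo p q, LC a U K u t) : Comp a U K u (Ioo p q) := by
  intro α hα β hβ hαβ z hz h0
  set S : Set ℝ := {s | ∀ x ∈ U, z (x, s) ≤ 0} with hS
  have hcl : IsClosed (S ∩ Icc α β) := by
    have : S ∩ Icc α β = Icc α β ∩ ⋂ x ∈ U, (Icc α β ∩ (fun s => z (x, s)) ⁻¹' (Iic 0)) := by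
      ext s
      simp only [hS, mem_inter_iff, mem_ofPred_eq, mem_iInter, mem_preimage, mem_Iic]
      constructor
      · rintro ⟨h1, h2⟩
        exact ⟨h2, fun x hx => ⟨h2, h1 x hx⟩⟩
      · rintro ⟨h2, h1⟩
        exact ⟨fun x hx => (h1 x hx).2, h2⟩
    rw [this]
    refine isClosed_Icc.inter (isClosed_biInter fun x hx => ?_)
    refine ContinuousOn.preimage_isClosed_of_isClosed ?_ isClosed_Icc isClosed_Iic
    exact fun s hs => (hz.dt x hx s hs).continuousAt.continuousWithinAt
  have := hcl.Icc_subset_of_forall_exists_gt h0 (fun t ht y hy => by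
    obtain ⟨δ, hδ, hC⟩ := h t ⟨hα.1.trans_le ht.2.1, ht.2.2.trans hβ.2⟩
    have hy' : t < y := hy
    have hs : t < min (min y β) (t + δ / 2) := lt_min (lt_min hy' ht.2.2) (by linarith)
    have hs2 : min (min y β) (t + δ / 2) ≤ t + δ / 2 := min_le_right _ _
    have hs3 : min (min y β) (t + δ / 2) ≤ min y β := min_le_left _ _
    have hs4 := hs3.trans (min_le_right _ _)
    have hs5 := hs3.trans (min_le_left _ _)
    refine ⟨min (min y β) (t + δ / 2), ?_, hs, hs5⟩
    exact hC t ⟨by linarith, by linarith⟩ _ ⟨by linarith, by linarith⟩ hs z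
      (hz.mono ht.2.1 hs4) ht.1)
  exact this ⟨hαβ.le, le_rfl⟩

/-- Lipschitz in space at time `t` with constant `k`. -/
def LipAt {n : ℕ} (K : Set (E n)) (u : E n × ℝ → ℝ) (k : ℝ) (t : ℝ) : Prop :=
  ∀ x ∈ K, ∀ y ∈ K, |u (x, t) - u (y, t)| ≤ k * dist x y

theorem right_closed (S : Setup a U K t₀ t₁ u) {p q k : ℝ} (hp : t₀ ≤ p) (hq : q ≤ t₁)
    (hF : ∀ t ∈ Ioo p q, LC a U K u t ∨ LipAt K u k t)
    (hα : p < α) (hβ : β < q) (h : SubOn a U K u z α β) {c : ℝ} (hc : 0 < c) {σ : ℝ}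
    (hσ : σ ∈ Ico α β) (hg : ∀ r ∈ Ioc σ β, ∃ x ∈ U, c ≤ z (x, r)) :
    ∃ x ∈ U, c ≤ z (x, σ) := by
  have hσI : σ ∈ Icc α β := ⟨hσ.1, hσ.2.le⟩
  by_cases hcase : ∃ δ > 0, ∀ t ∈ Ioo σ (σ + δ), t < q → LC a U K u t
  · obtain ⟨δ, hδ, hlc⟩ := hcase
    by_contra hcon
    push Not at hcon
    have hcc : ∃ c', 0 ≤ c' ∧ c' < c ∧ ∀ x ∈ U, z (x, σ) ≤ c' := by
      rcases K.eq_empty_or_nonempty with hKe | hKn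
      · exact ⟨0, le_rfl, hc, fun x hx => h.off x hx (by simp [hKe]) σ hσI⟩
      · obtain ⟨x, hxK, hmax⟩ := S.hK.exists_isMaxOn hKn (zslice_cont S h hσI)
        refine ⟨max (z (x, σ)) 0, le_max_right _ _, max_lt (hcon x (S.hKU hxK)) hc, ?_⟩
        intro y hy
        by_cases hyK : y ∈ K
        · exact (hmax hyK).trans (le_max_left _ _)
        · exact (h.off y hy hyK σ hσI).trans (le_max_right _ _)
    obtain ⟨c', hc0, hc1, hc2⟩ := hcc
    have hσq : σ < q := hσ.2.trans hβ
    set γ := min (σ + δ) q with hγ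
    have hγσ : σ < γ := lt_min (by linarith) hσq
    have hCo : Comp a U K u (Ioo σ γ) := comp_of_local fun t ht =>
      hlc t ⟨ht.1, ht.2.trans_le (min_le_left _ _)⟩ (ht.2.trans_le (min_le_right _ _))
    set β' := min β ((σ + γ) / 2) with hβ'
    have h1 : σ < β' := lt_min hσ.2 (by linarith)
    have h2 : β' ≤ β := min_le_left _ _
    have h3 : β' < γ := (min_le_right _ _).trans_lt (by linarith)
    have hz := (h.mono hσ.1 h2).sub_const S.hKU hc0
    have hj := no_jump S hz (by linarith [hσ.1]) h1 h3 ((min_le_right _ _).trans hq) hCo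
      (fun x hx => by have := hc2 x hx; linarith)
    obtain ⟨x, hx, hxc⟩ := hg β' ⟨h1, h2⟩
    have := hj x hx
    linarith
  · push Not at hcase
    have hfr : ∃ᶠ t in nhdsWithin σ (Ioi σ), t ∈ Ioc σ β ∧ LipAt K u k t := by
      rw [frequently_iff]
      intro V hV
      obtain ⟨w, hw, hwV⟩ := (mem_nhdsGT_iff_exists_Ioo_subset' (u' := β) hσ.2).1 hV
      have hw' : σ < w := hw
      obtain ⟨t, ht, htq, hnl⟩ := hcase (min w β - σ) (by
        have : σ < min w β := lt_min hw' hσ.2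
        linarith)
      have ht2 : t < min w β := by linarith [ht.2]
      have ht3 := ht2.trans_le (min_le_left _ _)
      have ht4 := ht2.trans_le (min_le_right _ _)
      refine ⟨t, hwV ⟨ht.1, ht3⟩, ⟨ht.1, ht4.le⟩, ?_⟩
      exact (hF t ⟨by linarith [hσ.1, ht.1], htq⟩).resolve_left hnl
    obtain ⟨s, hs, hsp⟩ := exists_seq_forall_of_frequently hfr
    have hs' : Tendsto s atTop (nhds σ) := hs.mono_right nhdsWithin_le_nhds
    choose x hxU hxc using fun j => hg (s j) (hsp j).1
    have hsI : ∀ j, s j ∈ Icc α β := fun j => ⟨hσ.1.trans (hsp j).1.1.le, (hsp j).1.2⟩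
    have hxK : ∀ j, x j ∈ K := by
      intro j
      by_contra hk
      have := h.off _ (hxU j) hk _ (hsI j)
      have := hxc j
      linarith
    obtain ⟨y, hyK, ψ, hψ, hlim⟩ := S.hK.tendsto_subseq hxK
    have hsψ : Tendsto (s ∘ ψ) atTop (nhds σ) := hs'.comp hψ.tendsto_atTop
    refine ⟨y, S.hKU hyK, ?_⟩
    have hσt : σ ∈ Ioo t₀ t₁ := ⟨by linarith [hσ.1], by linarith [hσ.2]⟩
    have hu2 : Tendsto (fun j => u (y, s (ψ j))) atTop (nhds (u (y, σ))) :=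
      (S.hut y (S.hKU hyK) σ hσt).tendsto.comp hsψ
    have hu1 : Tendsto (fun j => u (x (ψ j), s (ψ j)) - u (y, s (ψ j))) atTop (nhds 0) := by
      have h1 : Tendsto (fun j => k * dist (x (ψ j)) y) atTop (nhds 0) := by
        have := (tendsto_iff_dist_tendsto_zero.1 hlim).const_mul k
        simpa using this
      refine squeeze_zero_norm (fun j => ?_) h1
      exact (hsp (ψ j)).2 _ (hxK _) _ hyK
    have hd : Tendsto (fun j => u (x (ψ j), s (ψ j)) - z (x (ψ j), s (ψ j))) atTop
        (nhds (u (y, σ) - z (y, σ))) := by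
      have h1 := h.cont (y, σ) ⟨hyK, hσI⟩
      have h2 : Tendsto (fun j => (x (ψ j), s (ψ j))) atTop
          (nhdsWithin (y, σ) (K ×ˢ Icc α β)) := by
        refine tendsto_nhdsWithin_iff.2 ⟨hlim.prodMk_nhds hsψ, Eventually.of_forall fun j => ?_⟩
        exact ⟨hxK _, hsI _⟩
      exact h1.tendsto.comp h2
    have hfin := (hu1.add hu2).sub hd
    have e : (0 : ℝ) + u (y, σ) - (u (y, σ) - z (y, σ)) = z (y, σ) := by ring
    rw [e] at hfin
    refine ge_of_tendsto hfin (Eventually.of_forall fun j => ?_)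
    have := hxc (ψ j)
    linarith

theorem comp_of_lip (S : Setup a U K t₀ t₁ u) {p q k : ℝ} (hp : t₀ ≤ p) (hq : q ≤ t₁)
    (hF : ∀ t ∈ Ioo p q, LC a U K u t ∨ LipAt K u k t) : Comp a U K u (Ioo p q) := by
  intro α hα β hβ hαβ z h h0 x₀ hx₀
  by_contra hcon
  push Not at hcon
  set c := z (x₀, β) with hc
  set G : Set ℝ := {s | s ∈ Icc α β ∧ ∀ r ∈ Icc s β, ∃ x ∈ U, c ≤ z (x, r)} with hG
  have hβG : β ∈ G := ⟨⟨hαβ.le, le_rfl⟩, fun r hr => by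
    have : r = β := le_antisymm hr.2 hr.1
    exact ⟨x₀, hx₀, by rw [this]⟩⟩
  have hbb : BddBelow G := ⟨α, fun s hs => hs.1.1⟩
  set σ := sInf G with hσ
  have hσ1 : α ≤ σ := le_csInf ⟨β, hβG⟩ fun s hs => hs.1.1
  have hσ2 : σ ≤ β := csInf_le hbb hβG
  have hright : ∀ r ∈ Ioc σ β, ∃ x ∈ U, c ≤ z (x, r) := by
    intro r hr
    obtain ⟨s, hs, hsr⟩ := exists_lt_of_csInf_lt ⟨β, hβG⟩ hr.1
    exact hs.2 r ⟨hsr.le, hr.2⟩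
  have hgσ : ∃ x ∈ U, c ≤ z (x, σ) := by
    rcases hσ2.lt_or_eq with hlt | heq
    · exact right_closed S hp hq hF hα.1 hβ.2 h hcon ⟨hσ1, hlt⟩ hright
    · exact ⟨x₀, hx₀, by rw [heq]⟩
  rcases hσ1.lt_or_eq with hlt | heq
  · obtain ⟨x, hx, hev⟩ := back_step S h (by linarith [hα.1]) (by linarith [hβ.2])
      ⟨hσ1, hσ2⟩ hcon hgσ
    obtain ⟨w, hw, hwV⟩ := (mem_nhdsLT_iff_exists_Ioo_subset' (l' := α) hlt).1 hev
    have hw' : w < σ := hw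
    set s := (max w α + σ) / 2 with hs
    have hm : max w α < σ := max_lt hw' hlt
    have hm1 := le_max_left w α
    have hm2 := le_max_right w α
    have hsσ : s < σ := by linarith
    have : s ∈ G := by
      refine ⟨⟨by linarith, by linarith⟩, fun r hr => ?_⟩
      rcases lt_trichotomy r σ with h1 | h1 | h1
      · exact ⟨x, hx, hwV ⟨by linarith [hr.1], h1⟩⟩
      · rw [h1]; exact hgσ
      · exact hright r ⟨h1, hr.2⟩
    have := csInf_le hbb this
    linarith
  · obtain ⟨x, hx, hxc⟩ := hgσ
    rw [← heq] at hxc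
    have := h0 x hx
    linarith

theorem lip_exists (S : Setup a U K t₀ t₁ u) {t : ℝ} (ht : t ∈ Ioo t₀ t₁) :
    ∃ k : ℕ, LipAt K u k t := by
  have h1 : LocallyLipschitzOn K (fun x => u (x, t)) := by
    intro x hx
    obtain ⟨C, V, hV, hL⟩ := (S.hux x (S.hKU hx) t ht).exists_lipschitzOnWith
    exact ⟨C, V, mem_nhdsWithin_of_mem_nhds hV, hL⟩
  obtain ⟨C, hC⟩ := h1.exists_lipschitzOnWith_of_compact S.hK
  obtain ⟨k, hk⟩ := exists_nat_ge (C : ℝ)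
  refine ⟨k, fun x hx y hy => ?_⟩
  have := hC.dist_le_mul x hx y hy
  rw [Real.dist_eq] at this
  exact this.trans (mul_le_mul_of_nonneg_right hk dist_nonneg)

theorem comp_all (S : Setup a U K t₀ t₁ u) : Comp a U K u (Ioo t₀ t₁) := by
  refine comp_of_local fun t ht => ?_
  by_contra hcon
  set O : Set ℝ := {t | LC a U K u t} with hO
  have hOo : IsOpen O := by
    rw [isOpen_iff_mem_nhds]
    rintro s ⟨δ, hδ, hC⟩
    filter_upwards [Ioo_mem_nhds (show s - δ / 2 < s by linarith)
      (show s < s + δ / 2 by linarith)] with r hr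
    refine ⟨δ / 2, by linarith, hC.mono (Ioo_subset_Ioo ?_ ?_)⟩ <;> linarith [hr.1, hr.2]
  set F : Set ℝ := Ioo t₀ t₁ ∩ Oᶜ with hF
  have hFl : IsLocallyClosed F :=
    isOpen_Ioo.isLocallyClosed.inter hOo.isClosed_compl.isLocallyClosed
  have : LocallyCompactSpace F := hFl.locallyCompactSpace
  have : Nonempty F := ⟨⟨t, ht, hcon⟩⟩
  set T : ℕ → Set F := fun k => {s | LipAt K u k s} with hT
  have hTc : ∀ k, IsClosed (T k) := by
    intro k
    have : T k = ⋂ x ∈ K, ⋂ y ∈ K, {s : F | |u (x, s) - u (y, s)| ≤ k * dist x y} := by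
      ext s; simp [hT, LipAt]
    rw [this]
    have hcu : ∀ x ∈ K, Continuous fun s : F => u (x, (s : ℝ)) := by
      intro x hx
      rw [continuous_iff_continuousAt]
      intro s
      exact ContinuousAt.comp (f := fun s : F => (s : ℝ)) (g := fun r => u (x, r))
        (S.hut x (S.hKU hx) s s.2.1) continuous_subtype_val.continuousAt
    refine isClosed_biInter fun x hx => isClosed_biInter fun y hy => ?_
    exact isClosed_le ((hcu x hx).sub (hcu y hy)).abs continuous_const
  have hTu : ⋃ k, T k = univ := by
    ext s
    simp only [mem_iUnion, mem_univ, iff_true]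
    exact lip_exists S s.2.1
  obtain ⟨k, s, hs⟩ := nonempty_interior_of_iUnion_of_closed hTc hTu
  obtain ⟨V, hVo, hVe⟩ := isOpen_induced_iff.1 (isOpen_interior (s := T k))
  have hsV : (s : ℝ) ∈ V ∩ Ioo t₀ t₁ := by
    refine ⟨?_, s.2.1⟩
    rw [← hVe] at hs
    exact hs
  obtain ⟨δ, hδ, hball⟩ := Metric.isOpen_iff.1 (hVo.inter isOpen_Ioo) s hsV
  rw [Real.ball_eq_Ioo] at hball
  have hsub : Ioo ((s : ℝ) - δ) (s + δ) ⊆ Ioo t₀ t₁ := hball.trans inter_subset_right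
  have hb := (Ioo_subset_Ioo_iff (show (s : ℝ) - δ < s + δ by linarith)).1 hsub
  apply s.2.2
  refine ⟨δ, hδ, comp_of_lip S (k := k) hb.1 hb.2 fun r hr => ?_⟩
  by_cases hrO : r ∈ O
  · exact Or.inl hrO
  · right
    have : (⟨r, hsub hr, hrO⟩ : F) ∈ interior (T k) := by
      rw [← hVe]
      exact (hball hr).1
    exact interior_subset this
end


theorem comparison {n : ℕ} {ν : ℝ} {a : E n × ℝ → Fin n → Fin n → ℝ} {Ω : Set (E n)}
    {ω : E n × ℝ → Measure (E n × ℝ)} (hν : 0 < ν)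
    (ha : IsParabolicCoeff ν a (closure (Cyl Ω))) (hω : IsCaloricMeasure a Ω ω)
    {φ : E n × ℝ → ℝ} (hφ : Continuous φ) (hφ0 : ∀ Z, 0 ≤ φ Z) (hφ1 : ∀ Z, φ Z ≤ 1)
    {U : Set (E n)} (hU : IsOpen U) (hUΩ : U ⊆ Ω) (hUb : Bornology.IsBounded U)
    {t0 t1 : ℝ} (h0 : 0 ≤ t0) {v : E n × ℝ → ℝ} (hv : ContDiff ℝ 2 v)
    (hL : ∀ x ∈ U, ∀ t ∈ Ioo t0 t1, 0 ≤ LVal a v (x, t))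
    (hb : ∀ x ∈ closure U, ∀ t ∈ Ico t0 t1, (x ∉ U ∨ t = t0) →
      v (x, t) ≤ 0 ∨ ((x, t) ∈ pB Ω ∧ v (x, t) ≤ φ (x, t)))
    {x₁ : E n} (hx₁ : x₁ ∈ U) {T : ℝ} (hT : T ∈ Ioo t0 t1) :
    v (x₁, T) ≤ ∫ Z, φ Z ∂ω (x₁, T) := by
  obtain ⟨⟨hsm, hsol⟩, hbd⟩ := hω.2 φ hφ ⟨1, fun Z => by rw [abs_of_nonneg (hφ0 Z)]; exact hφ1 Z⟩
  set u0 : E n × ℝ → ℝ := fun X => ∫ Z, φ Z ∂ω X with hu0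
  have hu0n : ∀ X, 0 ≤ u0 X := fun X => integral_nonneg hφ0
  have hcyl : U ×ˢ Ioo t0 t1 ⊆ Cyl Ω := by
    rintro ⟨x, t⟩ ⟨hx, ht⟩
    exact ⟨hUΩ hx, h0.trans_lt ht.1⟩
  have hsub := hcyl.trans subset_closure
  suffices H : ∀ ε > 0, v (x₁, T) ≤ u0 (x₁, T) + ε by
    exact le_of_forall_pos_le_add H
  intro ε' hε'
  set ε := ε' / (1 + (T - t0)) with hε
  have hTt : 0 < 1 + (T - t0) := by linarith [hT.1]
  have hε0 : 0 < ε := div_pos hε' hTt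
  set z : E n × ℝ → ℝ := fun X => v X - u0 X - ε * (1 + (X.2 - t0)) with hz
  suffices H : z (x₁, T) ≤ 0 by
    simp only [hz] at H
    have : ε * (1 + (T - t0)) = ε' := by rw [hε]; field_simp
    linarith
  by_contra hcon
  push Not at hcon
  have hlocal : ∀ x ∈ closure U, ∀ t ∈ Ico t0 t1, (x ∉ U ∨ t = t0) →
      ∀ᶠ X in nhdsWithin (x, t) (U ×ˢ Ioo t0 t1), z X ≤ 0 := by
    intro x hx t ht hxt
    have hcv : Tendsto v (nhdsWithin (x, t) (U ×ˢ Ioo t0 t1)) (nhds (v (x, t))) :=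
      (hv.continuous.tendsto _).mono_left nhdsWithin_le_nhds
    rcases hb x hx t ht hxt with h1 | ⟨h1, h2⟩
    · filter_upwards [hcv.eventually (Iio_mem_nhds (show v (x, t) < ε by linarith)),
        self_mem_nhdsWithin] with X hX1 hX2
      have h3 : v X < ε := hX1
      have h4 := hu0n X
      have h5 : 0 ≤ ε * (X.2 - t0) := mul_nonneg hε0.le (by linarith [hX2.2.1])
      simp only [hz]
      linarith
    · have h3 : Tendsto u0 (nhdsWithin (x, t) (U ×ˢ Ioo t0 t1)) (nhds (φ (x, t))) :=
        (hbd (x, t) h1).mono_left (nhdsWithin_mono _ hcyl)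
      have h4 := hcv.sub h3
      filter_upwards [h4.eventually (Iio_mem_nhds (show v (x, t) - φ (x, t) < ε by linarith)),
        self_mem_nhdsWithin] with X hX1 hX2
      have h3 : v X - u0 X < ε := hX1
      have h5 : 0 ≤ ε * (X.2 - t0) := mul_nonneg hε0.le (by linarith [hX2.2.1])
      simp only [hz]
      linarith
  set P : Set (E n × ℝ) := {X | X ∈ U ×ˢ Ioc t0 T ∧ 0 < z X} with hP
  have hPsub : P ⊆ U ×ˢ Ioo t0 t1 := fun X hX => ⟨hX.1.1, hX.1.2.1, hX.1.2.2.trans_lt hT.2⟩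
  have hPb : Bornology.IsBounded P :=
    (hUb.prod (isCompact_Icc (a := t0) (b := T)).isBounded).subset
      fun X hX => ⟨hX.1.1, hX.1.2.1.le, hX.1.2.2⟩
  have hPc : IsCompact (closure P) := hPb.isCompact_closure
  have hcl : ∀ X ∈ closure P, X.1 ∈ closure U ∧ X.2 ∈ Icc t0 T := by
    have : closure P ⊆ closure U ×ˢ Icc t0 T := by
      refine closure_minimal ?_ (isClosed_closure.prod isClosed_Icc)
      exact fun X hX => ⟨subset_closure hX.1.1, hX.1.2.1.le, hX.1.2.2⟩
    exact fun X hX => this hX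
  have hint : ∀ X ∈ closure P, X.1 ∈ U ∧ X.2 ≠ t0 := by
    intro X hX
    by_contra hc
    have h1 : X.1 ∉ U ∨ X.2 = t0 := by
      by_cases hXU : X.1 ∈ U
      · right; by_contra h2; exact hc ⟨hXU, h2⟩
      · exact Or.inl hXU
    have h2 := hlocal X.1 (hcl X hX).1 X.2 ⟨(hcl X hX).2.1, (hcl X hX).2.2.trans_lt hT.2⟩ h1
    have h3 := eventually_nhdsWithin_iff.1 h2
    obtain ⟨W, hW1, hW2⟩ := (mem_closure_iff_frequently.1 hX).and_eventually h3 |>.exists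
    exact absurd (hW2 (hPsub hW1)) (not_le.2 hW1.2)
  set K : Set (E n) := Prod.fst '' closure P with hK
  have hKc : IsCompact K := hPc.image continuous_fst
  have hKU : K ⊆ U := by
    rintro _ ⟨X, hX, rfl⟩
    exact (hint X hX).1
  have hX₁ : (x₁, T) ∈ P := ⟨⟨hx₁, hT.1, le_rfl⟩, hcon⟩
  obtain ⟨Xm, hXm, hmin⟩ := hPc.exists_isMinOn ⟨_, subset_closure hX₁⟩
    (continuous_snd.continuousOn (s := closure P))
  have hm1 : t0 < Xm.2 := lt_of_le_of_ne (hcl Xm hXm).2.1 (Ne.symm (hint Xm hXm).2)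
  have hm2 : Xm.2 ≤ T := (hcl Xm hXm).2.2
  set α := (t0 + Xm.2) / 2 with hα
  have hα1 : t0 < α := by linarith
  have hα2 : α < Xm.2 := by linarith
  have hαT : α < T := by linarith
  have hIcc : ∀ t ∈ Icc α T, t ∈ Ioo t0 t1 := fun t ht =>
    ⟨by linarith [ht.1], ht.2.trans_lt hT.2⟩
  have hu0x : ∀ x ∈ U, ∀ t ∈ Ioo t0 t1, ContDiffAt ℝ 2 (fun y => u0 (y, t)) x :=
    fun x hx t ht => (hsm (x, t) (hcyl ⟨hx, ht⟩)).1
  have hu0t : ∀ x ∈ U, ∀ t ∈ Ioo t0 t1, DifferentiableAt ℝ (fun s => u0 (x, s)) t :=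
    fun x hx t ht => (hsm (x, t) (hcyl ⟨hx, ht⟩)).2
  have S : Setup a U K t0 t1 (fun X => - u0 X) := by
    refine ⟨hU, hKc, hKU, ?_, ?_, ?_, ?_⟩
    · intro x hx t ht ξ
      refine le_trans ?_ ((ha.2 (x, t) (hsub ⟨hx, ht⟩)).1 ξ)
      exact mul_nonneg hν.le (Finset.sum_nonneg fun i _ => sq_nonneg _)
    · intro i j
      refine ((ha.1 i j).mono hsub).of_le ?_
      exact WithTop.coe_le_coe.2 (le_top : (2 : ℕ∞) ≤ ⊤)
    · intro x hx t ht
      exact ((hu0x x hx t ht).of_le (by norm_num)).neg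
    · intro x hx t ht
      exact (hu0t x hx t ht).continuousAt.neg
  have hvx : ∀ x t, ContDiffAt ℝ 2 (fun y => v (y, t)) x := fun x t =>
    cd_slice hv.contDiffAt
  have hvt : ∀ x t, DifferentiableAt ℝ (fun s => v (x, s)) t := fun x t => by
    have h1 : DifferentiableAt ℝ v (x, t) := (hv.differentiable (by norm_num)) _
    exact DifferentiableAt.comp (f := fun s : ℝ => (x, s)) t h1
      ((differentiableAt_const x).prodMk differentiableAt_id)
  have hsubon : SubOn a U K (fun X => - u0 X) z α T := by
    refine ⟨?_, ?_, ?_, ?_, ?_, ?_⟩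
    · have e : (fun X => - u0 X - z X) = fun X => ε * (1 + (X.2 - t0)) - v X := by
        funext X; simp only [hz]; ring
      rw [e]
      have := hv.continuous
      exact (by fun_prop : Continuous fun X : E n × ℝ => ε * (1 + (X.2 - t0)) - v X).continuousOn
    · obtain ⟨B, hB⟩ := (hUb.isCompact_closure.prod (isCompact_Icc (a := α) (b := T))).bddAbove_image
        hv.continuous.continuousOn
      refine ⟨B, fun x hx t ht => ?_⟩
      have h1 : v (x, t) ≤ B := hB ⟨(x, t), ⟨subset_closure hx, ht⟩, rfl⟩
      have h2 := hu0n (x, t)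
      have h5 : 0 ≤ ε * (1 + (t - t0)) := mul_nonneg hε0.le (by linarith [ht.1])
      simp only [hz]
      linarith
    · intro x hx t ht
      have h7 : ContDiffAt ℝ 2 (fun _ : E n => ε * (1 + (t - t0))) x := contDiffAt_const
      exact ((hvx x t).sub (hu0x x hx t (hIcc t ht))).sub h7
    · intro x hx t ht
      exact ((hvt x t).sub (hu0t x hx t (hIcc t ht))).sub (by fun_prop)
    · intro x hx hk t ht
      by_contra hc
      push Not at hc
      exact hk ⟨(x, t), subset_closure ⟨⟨hx, (hIcc t ht).1, ht.2⟩, hc⟩, rfl⟩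
    · intro x hx t ht
      have hxU := hKU hx
      have htI := hIcc t ht
      have h1 := hL x hxU t htI
      have h2 := hsol (x, t) (hcyl ⟨hxU, htI⟩)
      unfold LVal at h1 h2 ⊢
      have e1 : ∀ i j, D2 z (x, t) i j = D2 v (x, t) i j - D2 u0 (x, t) i j := by
        intro i j
        simp only [D2_eq_D2x, hz]
        rw [D2x_sub_const, D2x_sub (hvx x t) (hu0x x hxU t htI)]
      have e2 : Dt z (x, t) = Dt v (x, t) - Dt u0 (x, t) - ε := by
        unfold Dt
        have h3 : HasDerivAt (fun s : ℝ => ε * (1 + (s - t0))) ε t := by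
          simpa using (((hasDerivAt_id t).sub_const t0).const_add 1).const_mul ε
        exact (((hvt x t).hasDerivAt.sub (hu0t x hxU t htI).hasDerivAt).sub h3).deriv
      simp only [e1, e2]
      simp only [mul_sub, Finset.sum_sub_distrib]
      linarith
  have hfin := comp_all S α ⟨hα1, hαT.trans hT.2⟩ T hT hαT z hsubon (fun x hx => by
    by_contra hc
    push Not at hc
    have h1 : (x, α) ∈ P := ⟨⟨hx, hα1, hαT.le⟩, hc⟩
    have h2 : Xm.2 ≤ α := hmin (subset_closure h1)
    linarith) x₁ hx₁
  linarith


theorem fderiv_nsq {n : ℕ} (y x : E n) (j : Fin n) :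
    fderiv ℝ (fun x => ‖x - y‖ ^ 2) x (EuclideanSpace.single j 1) = 2 * (x j - y j) := by
  have h := (hasStrictFDerivAt_norm_sq (x - y)).hasFDerivAt.comp x ((hasFDerivAt_id x).sub_const y)
  have h2 : fderiv ℝ (fun x => ‖x - y‖ ^ 2) x = _ := h.fderiv
  rw [h2]
  simp [EuclideanSpace.inner_single_right]

theorem contDiff_nsq {n : ℕ} (y : E n) : ContDiff ℝ 2 (fun x : E n => ‖x - y‖ ^ 2) :=
  (contDiff_id.sub contDiff_const).norm_sq ℝ

theorem D2x_nsq {n : ℕ} (y x : E n) (i j : Fin n) :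
    D2x (fun x => ‖x - y‖ ^ 2) x i j = if i = j then 2 else 0 := by
  unfold D2x
  simp only [fderiv_nsq]
  have h1 : HasFDerivAt (fun x : E n => x j) (EuclideanSpace.proj j : E n →L[ℝ] ℝ) x :=
    (EuclideanSpace.proj j : E n →L[ℝ] ℝ).hasFDerivAt
  have h2 := ((h1.sub_const (y j)).const_mul 2).fderiv
  rw [h2]
  by_cases hij : i = j
  · subst hij; simp
  · simp [hij, Ne.symm hij]

theorem LVal_radial {n : ℕ} (a : E n × ℝ → Fin n → Fin n → ℝ) (y : E n) {P P' P'' : ℝ → ℝ}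
    (h1 : ∀ s, HasDerivAt P (P' s) s) (h2 : ∀ s, HasDerivAt P' (P'' s) s) {G : ℝ → ℝ} {G' c : ℝ}
    {t : ℝ} (hG : HasDerivAt G G' t) (x : E n) :
    LVal a (fun X => P (‖X.1 - y‖ ^ 2) * G X.2 - c) (x, t) =
      G t * (4 * P'' (‖x - y‖ ^ 2) * (∑ i, ∑ j, a (x, t) i j * (x - y) i * (x - y) j)
        + 2 * P' (‖x - y‖ ^ 2) * ∑ i, a (x, t) i i) - P (‖x - y‖ ^ 2) * G' := by
  unfold LVal
  have e1 : ∀ i j, D2 (fun X : E n × ℝ => P (‖X.1 - y‖ ^ 2) * G X.2 - c) (x, t) i j =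
      G t * (4 * P'' (‖x - y‖ ^ 2) * ((x - y) i * (x - y) j)) +
        G t * (P' (‖x - y‖ ^ 2) * (if i = j then 2 else 0)) := by
    intro i j
    rw [D2_eq_D2x]
    simp only
    have := D2x_comp (f := fun x => ‖x - y‖ ^ 2) (x := x) (contDiff_nsq y).contDiffAt
      (p := fun s => P s * G t - c) (p' := fun s => P' s * G t) (p'' := fun s => P'' s * G t)
      (fun s => ((h1 s).mul_const (G t)).sub_const c) (fun s => (h2 s).mul_const (G t)) i j
    rw [this, fderiv_nsq, fderiv_nsq, D2x_nsq]
    simp only [PiLp.sub_apply]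
    ring
  have e2 : Dt (fun X : E n × ℝ => P (‖X.1 - y‖ ^ 2) * G X.2 - c) (x, t) =
      P (‖x - y‖ ^ 2) * G' := by
    unfold Dt
    exact ((hG.const_mul (P (‖x - y‖ ^ 2))).sub_const c).deriv
  rw [e2]
  simp only [e1]
  congr 1
  have e3 : ∀ i j, a (x, t) i j * (G t * (4 * P'' (‖x - y‖ ^ 2) * ((x - y) i * (x - y) j)) +
        G t * (P' (‖x - y‖ ^ 2) * (if i = j then 2 else 0))) =
      G t * (4 * P'' (‖x - y‖ ^ 2)) * (a (x, t) i j * (x - y) i * (x - y) j) +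
        G t * (2 * P' (‖x - y‖ ^ 2)) * (if i = j then a (x, t) i j else 0) := by
    intro i j
    split_ifs <;> ring
  simp only [e3, Finset.sum_add_distrib, ← Finset.mul_sum, Finset.sum_ite_eq, Finset.mem_univ,
    if_true]
  ring

theorem coeff_facts {n : ℕ} {ν : ℝ} {A : Fin n → Fin n → ℝ}
    (h1 : ∀ ξ : Fin n → ℝ, ν * ∑ i, ξ i ^ 2 ≤ ∑ i, ∑ j, A i j * ξ i * ξ j)
    (h2 : ∀ i j, |A i j| ≤ ν⁻¹) (d : E n) :
    ν * ‖d‖ ^ 2 ≤ (∑ i, ∑ j, A i j * d i * d j) ∧ ∑ i, A i i ≤ n / ν := by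
  constructor
  · have := h1 d
    rwa [EuclideanSpace.real_norm_sq_eq]
  · calc ∑ i, A i i ≤ ∑ _i : Fin n, ν⁻¹ := Finset.sum_le_sum fun i _ => (abs_le.1 (h2 i i)).2
      _ = n / ν := by simp [div_eq_mul_inv]

/-- From a subsolution barrier to a lower bound of the caloric measure. -/
theorem measure_lower {n : ℕ} {ν : ℝ} {a : E n × ℝ → Fin n → Fin n → ℝ} {Ω : Set (E n)}
    {ω : E n × ℝ → Measure (E n × ℝ)} (hν : 0 < ν) (hΩ : IsOpen Ω)
    (ha : IsParabolicCoeff ν a (closure (Cyl Ω))) (hω : IsCaloricMeasure a Ω ω)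
    {y s : _} {r : ℝ} (hr : 0 < r) {y' : E n} {R : ℝ} (hR : R + dist y' y ≤ 7 / 4 * r)
    {t0 t1 : ℝ} (h0 : 0 ≤ t0) (ht0 : s - 3 * r ^ 2 ≤ t0) (ht1 : t1 ≤ s + 3 * r ^ 2)
    {v : E n × ℝ → ℝ} (hv : ContDiff ℝ 2 v)
    (hL : ∀ x ∈ Ω, dist x y' < R → ∀ t ∈ Ioo t0 t1, 0 ≤ LVal a v (x, t))
    (hv1 : ∀ x, dist x y' ≤ R → ∀ t ∈ Ico t0 t1, v (x, t) ≤ 1)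
    (hv0 : ∀ x, dist x y' = R → ∀ t ∈ Ico t0 t1, v (x, t) ≤ 0)
    (hbot : t0 = 0 ∨ ∀ x, v (x, t0) ≤ 0)
    {x : E n} (hxΩ : x ∈ Ω) (hx : dist x y' < R) {T : ℝ} (hT : T ∈ Ioo t0 t1) :
    ENNReal.ofReal (v (x, T)) ≤ ω (x, T) (pB Ω ∩ Cr (y, s) (2 * r)) := by
  have hopen : IsOpen (Cr (y, s) (2 * r)) := isOpen_ball.prod isOpen_Ioo
  obtain ⟨φ, hφ0, hφ1, hφ⟩ := exists_continuous_zero_one_of_isClosed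
    (s := (Cr (y, s) (2 * r))ᶜ)
    (t := closedBall y (7 / 4 * r) ×ˢ Icc (s - 3 * r ^ 2) (s + 3 * r ^ 2))
    hopen.isClosed_compl (isClosed_closedBall.prod isClosed_Icc) (by
      rw [Set.disjoint_left]
      intro Z hZ hZ2
      apply hZ
      refine ⟨?_, ?_, ?_⟩
      · have : dist Z.1 y ≤ 7 / 4 * r := hZ2.1
        show dist Z.1 y < 2 * r
        linarith
      · have := hZ2.2.1
        show s - (2 * r) ^ 2 < Z.2
        nlinarith
      · have := hZ2.2.2
        show Z.2 < s + (2 * r) ^ 2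
        nlinarith)
  have hcomp : v (x, T) ≤ ∫ Z, φ Z ∂ω (x, T) := by
    refine comparison hν ha hω φ.continuous (fun Z => (hφ Z).1) (fun Z => (hφ Z).2)
      (U := Ω ∩ ball y' R) (hΩ.inter isOpen_ball) inter_subset_left
      (isBounded_ball.subset inter_subset_right) h0 hv
      (fun x hx t ht => hL x hx.1 hx.2 t ht) ?_ ⟨hxΩ, hx⟩ hT
    intro x hx t ht hxt
    have hxΩ : x ∈ closure Ω := closure_mono inter_subset_left hx
    have hxc : dist x y' ≤ R := closure_ball_subset_closedBall (closure_mono inter_subset_right hx)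
    rcases hxc.eq_or_lt with hxR | hxR
    · exact Or.inl (hv0 x hxR t ht)
    have hφx : φ (x, t) = 1 := by
      refine hφ1 ⟨?_, ?_, ?_⟩
      · show dist x y ≤ 7 / 4 * r
        linarith [dist_triangle x y' y]
      · exact ht0.trans ht.1
      · exact ht.2.le.trans ht1
    by_cases htt : t = t0
    · rcases hbot with h | h
      · right
        refine ⟨Or.inr ⟨hxΩ, ?_⟩, ?_⟩
        · show t = 0
          rw [htt, h]
        · rw [hφx]; exact hv1 x hxc t ht
      · left; rw [htt]; exact h x
    · have hxU := hxt.resolve_right htt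
      have hxn : x ∉ Ω := fun h => hxU ⟨h, hxR⟩
      right
      refine ⟨Or.inl ⟨?_, ?_⟩, ?_⟩
      · rw [hΩ.frontier_eq]; exact ⟨hxΩ, hxn⟩
      · exact h0.trans_lt (lt_of_le_of_ne ht.1 (Ne.symm htt))
      · rw [hφx]; exact hv1 x hxc t ht
  obtain ⟨hprob, hnull⟩ := hω.1 (x, T) ⟨hxΩ, h0.trans_lt hT.1⟩
  have hint : ∫ Z, φ Z ∂ω (x, T) ≤ (ω (x, T)).real (Cr (y, s) (2 * r)) := by
    rw [← integral_indicator_one hopen.measurableSet]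
    refine integral_mono ?_ ?_ ?_
    · refine Integrable.of_bound φ.continuous.aestronglyMeasurable 1 (Eventually.of_forall fun Z => ?_)
      rw [Real.norm_of_nonneg (hφ Z).1]; exact (hφ Z).2
    · exact (integrable_const (1 : ℝ)).indicator hopen.measurableSet
    · intro Z
      by_cases hZ : Z ∈ Cr (y, s) (2 * r)
      · simp only [indicator_of_mem hZ, Pi.one_apply]; exact (hφ Z).2
      · rw [indicator_of_notMem hZ]; exact (hφ0 hZ).le
  have hm : ω (x, T) (pB Ω ∩ Cr (y, s) (2 * r)) = ω (x, T) (Cr (y, s) (2 * r)) := by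
    rw [inter_comm]
    exact measure_inter_conull hnull
  rw [hm]
  exact ENNReal.ofReal_le_of_le_toReal (hcomp.trans hint)

/-- Exterior ball coming from the Lipschitz graph condition. -/
theorem exterior_ball {n : ℕ} (hn : 0 < n) {Ω : Set (E n)} {m r₀ : ℝ}
    (hΩ : IsLipschitzDomain hn Ω m r₀) {y : E n} (hy : y ∈ frontier Ω) {r : ℝ} (hr : 0 < r)
    (hr0 : r ≤ r₀ / 2) :
    ∃ y' : E n, dist y' y = r / 4 ∧ ∀ x ∈ Ω, 1 / (4 * (1 + |m|)) * r ≤ dist x y' := by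
  obtain ⟨hO, -, -, hm, hr₀, hg⟩ := hΩ
  obtain ⟨T, φ, hφ, hiff⟩ := hg y hy
  rw [abs_of_pos hm]
  set N : Fin n := ⟨n - 1, Nat.sub_lt hn Nat.one_pos⟩ with hN
  set e : E n := EuclideanSpace.single N (r / 4) with he
  have hne : ‖e‖ = r / 4 := by
    rw [he, PiLp.norm_single, Real.norm_of_nonneg (by linarith)]
  set δ : ℝ := 1 / (4 * (1 + m)) with hδ
  have hδm : δ * (1 + m) = 1 / 4 := by rw [hδ]; field_simp
  have hδ0 : 0 < δ := by rw [hδ]; positivity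
  have hδ1 : δ ≤ 1 / 4 := by nlinarith
  refine ⟨y - T.symm e, ?_, ?_⟩
  · rw [dist_eq_norm]
    have : y - T.symm e - y = -(T.symm e) := by abel
    rw [this, norm_neg, T.symm.norm_map, hne]
  · intro x hx
    by_contra hcon
    push Not at hcon
    set w : E n := T (x - (y - T.symm e)) with hw
    have hwn : ‖w‖ < δ * r := by rw [hw, T.norm_map, ← dist_eq_norm]; exact hcon
    have hTx : T (x - y) = w - e := by
      rw [hw]
      have : x - (y - T.symm e) = (x - y) + T.symm e := by abel
      rw [this, map_add, T.apply_symm_apply]; abel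
    have hxy : ‖x - y‖ < r₀ := by
      rw [← T.norm_map, hTx]
      have := norm_sub_le w e
      nlinarith
    have hxin := ((hiff x).1 ⟨hx, by rw [mem_ball, dist_eq_norm]; exact hxy⟩).2
    have hyn : y ∉ Ω := by
      rw [hO.frontier_eq] at hy; exact hy.2
    have hφ0 : 0 ≤ φ 0 := by
      by_contra hneg
      push Not at hneg
      have := (hiff y).2 ⟨by simpa using hr₀, by
        have e0 : ((EuclideanSpace.equiv (Fin (n - 1)) ℝ).symm
            (fun i => T (y - y) (Fin.castLE (Nat.sub_le n 1) i))) = 0 := by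
          ext i; simp
        rw [e0]; simpa using hneg⟩
      exact hyn this.1
    set x' : E (n - 1) := (EuclideanSpace.equiv (Fin (n - 1)) ℝ).symm
            (fun i => T (x - y) (Fin.castLE (Nat.sub_le n 1) i)) with hx'
    have hx'i : ∀ i, x' i = w (Fin.castLE (Nat.sub_le n 1) i) := by
      intro i
      have h1 : x' i = T (x - y) (Fin.castLE (Nat.sub_le n 1) i) := rfl
      rw [h1, hTx]
      have h2 : e (Fin.castLE (Nat.sub_le n 1) i) = 0 := by
        rw [he]
        have : Fin.castLE (Nat.sub_le n 1) i ≠ N := by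
          intro h
          have := congrArg Fin.val h
          simp [hN] at this
          omega
        simp [this]
      simp [h2]
    have hx'n : ‖x'‖ ≤ ‖w‖ := by
      refine le_of_sq_le_sq ?_ (norm_nonneg _)
      rw [EuclideanSpace.real_norm_sq_eq, EuclideanSpace.real_norm_sq_eq]
      simp only [hx'i]
      have hinj : Function.Injective (Fin.castLE (Nat.sub_le n 1)) := Fin.castLE_injective _
      calc ∑ i, w (Fin.castLE (Nat.sub_le n 1) i) ^ 2
          = ∑ k ∈ Finset.univ.map ⟨_, hinj⟩, w k ^ 2 := by rw [Finset.sum_map]; rfl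
        _ ≤ ∑ k, w k ^ 2 := Finset.sum_le_sum_of_subset_of_nonneg (Finset.subset_univ _)
            fun _ _ _ => sq_nonneg _
    have hlip : |φ x' - φ 0| ≤ m * ‖x'‖ := by
      have := hφ.dist_le_mul x' 0
      rwa [Real.dist_eq, dist_zero_right, Real.coe_toNNReal m hm.le] at this
    have hwN : w N ≤ ‖w‖ := (le_abs_self _).trans (by
      have := PiLp.norm_apply_le w N
      rwa [Real.norm_eq_abs] at this)
    have heN : (w - e) N = w N - r / 4 := by simp [he]
    rw [hTx, heN] at hxin
    have h1 := (abs_le.1 hlip).1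
    have h2 : m * ‖x'‖ ≤ m * (δ * r) := mul_le_mul_of_nonneg_left (by linarith) hm.le
    have h3 : δ * r + m * (δ * r) = r / 4 := by
      have : δ * r + m * (δ * r) = δ * (1 + m) * r := by ring
      rw [this, hδm]; ring
    linarith


theorem contDiff_radial {n : ℕ} (y : E n) {P G : ℝ → ℝ} (hP : ContDiff ℝ 2 P)
    (hG : ContDiff ℝ 2 G) (c : ℝ) :
    ContDiff ℝ 2 (fun X : E n × ℝ => P (‖X.1 - y‖ ^ 2) * G X.2 - c) := by
  have h1 : ContDiff ℝ 2 (fun X : E n × ℝ => ‖X.1 - y‖ ^ 2) := (contDiff_nsq y).comp contDiff_fst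
  exact ((hP.comp h1).mul (hG.comp contDiff_snd)).sub contDiff_const

/-- Lateral case. -/
theorem lateral_case {n : ℕ} {ν : ℝ} {a : E n × ℝ → Fin n → Fin n → ℝ} {Ω : Set (E n)}
    {ω : E n × ℝ → Measure (E n × ℝ)} (hν : 0 < ν) (hΩ : IsOpen Ω)
    (ha : IsParabolicCoeff ν a (closure (Cyl Ω))) (hω : IsCaloricMeasure a Ω ω)
    {y : E n} {s : ℝ} {r : ℝ} (hr : 0 < r) {y' : E n} {δ : ℝ} (hδ : 0 < δ)
    (hy' : dist y' y = r / 4) (hext : ∀ x ∈ Ω, δ * r ≤ dist x y') {A : ℝ} (hA : 0 < A)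
    (hA2 : 2 * (n / ν) + 9 / 10 ≤ 4 * A * ν * δ ^ 2)
    {x : E n} (hxΩ : x ∈ Ω) (hx : dist x y < r) {T : ℝ} (hT0 : 0 < T) (hT1 : s - r ^ 2 < T)
    (hT2 : T < s + r ^ 2) :
    ENNReal.ofReal (Real.exp (-(161 / 80) * A) - Real.exp (-(9 / 4) * A)) ≤
      ω (x, T) (pB Ω ∩ Cr (y, s) (2 * r)) := by
  have hr2 : 0 < r ^ 2 := by positivity
  set T1 := T + r ^ 2 / 2 with hT1d
  set b := A / r ^ 2 with hb
  have hb0 : 0 < b := div_pos hA hr2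
  have hbr : b * r ^ 2 = A := by rw [hb]; field_simp
  set P : ℝ → ℝ := fun q => Real.exp (-b * q) with hP
  set G : ℝ → ℝ := fun t => Real.exp (9 / 10 * b * (t - T1)) with hG
  set c := Real.exp (-(9 / 4) * A) with hc
  have hc0 : 0 < c := Real.exp_pos _
  have hP1 : ∀ q, HasDerivAt P (-b * Real.exp (-b * q)) q := by
    intro q
    have := ((hasDerivAt_id q).const_mul (-b)).exp
    simpa [hP, mul_comm] using this
  have hP2 : ∀ q, HasDerivAt (fun q => -b * Real.exp (-b * q)) (b ^ 2 * Real.exp (-b * q)) q := by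
    intro q
    have := (hP1 q).const_mul (-b)
    have e : -b * (-b * Real.exp (-b * q)) = b ^ 2 * Real.exp (-b * q) := by ring
    rwa [e] at this
  have hG1 : ∀ t, HasDerivAt G (9 / 10 * b * G t) t := by
    intro t
    have := (((hasDerivAt_id t).sub_const T1).const_mul (9 / 10 * b)).exp
    simpa [hG, mul_comm] using this
  have hPle : ∀ x : E n, P (‖x - y'‖ ^ 2) ≤ 1 := by
    intro x
    rw [hP]; simp only
    rw [Real.exp_le_one_iff]
    have : 0 ≤ b * ‖x - y'‖ ^ 2 := by positivity
    linarith
  have hGle : ∀ t ≤ T1, G t ≤ 1 := by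
    intro t ht
    rw [hG]; simp only
    rw [Real.exp_le_one_iff]
    have : 0 ≤ b * (T1 - t) := mul_nonneg hb0.le (by linarith)
    linarith
  have hP0 : ∀ q, 0 < P q := fun q => Real.exp_pos _
  have hG0 : ∀ q, 0 < G q := fun q => Real.exp_pos _
  have hxy' : dist x y' < 5 / 4 * r := by
    have := dist_triangle x y y'
    rw [dist_comm y y', hy'] at this
    linarith
  have key := measure_lower (y := y) (s := s) (r := r) (y' := y') (R := 3 / 2 * r)
    (t0 := max 0 (s - 3 * r ^ 2)) (t1 := T1)
    (v := fun X => P (‖X.1 - y'‖ ^ 2) * G X.2 - c) hν hΩ ha hω hr (by rw [hy']; linarith)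
    (le_max_left _ _) (le_max_right _ _) (by linarith)
    (contDiff_radial y' (by rw [hP]; fun_prop) (by rw [hG]; fun_prop) c)
    (by
      intro x hx hxR t ht
      rw [LVal_radial a y' hP1 hP2 (hG1 t) x]
      have hmem : (x, t) ∈ closure (Cyl Ω) :=
        subset_closure ⟨hx, (le_max_left _ _).trans_lt ht.1⟩
      obtain ⟨f1, f2⟩ := coeff_facts (ha.2 _ hmem).1 (ha.2 _ hmem).2 (x - y')
      set S := ∑ i, ∑ j, a (x, t) i j * (x - y') i * (x - y') j
      set tr := ∑ i, a (x, t) i i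
      have hq : (δ * r) ^ 2 ≤ ‖x - y'‖ ^ 2 := by
        have := hext x hx
        rw [dist_eq_norm] at this
        gcongr
      have e : G t * (4 * (b ^ 2 * Real.exp (-b * ‖x - y'‖ ^ 2)) * S +
          2 * (-b * Real.exp (-b * ‖x - y'‖ ^ 2)) * tr) -
          P (‖x - y'‖ ^ 2) * (9 / 10 * b * G t) =
          G t * P (‖x - y'‖ ^ 2) * b * (4 * b * S - 2 * tr - 9 / 10) := by
        simp only [hP]; ring
      rw [e]
      have h1 : ν * (δ * r) ^ 2 ≤ S := (mul_le_mul_of_nonneg_left hq hν.le).trans f1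
      have h2 : b * (ν * (δ * r) ^ 2) ≤ b * S := mul_le_mul_of_nonneg_left h1 hb0.le
      have h3 : b * (ν * (δ * r) ^ 2) = A * ν * δ ^ 2 := by
        rw [← hbr]; ring
      have h4 := hP0 (‖x - y'‖ ^ 2)
      have h5 := hG0 t
      refine mul_nonneg (by positivity) ?_
      linarith)
    (by
      intro x _ t ht
      have h1 := hPle x
      have h2 := hGle t ht.2.le
      have h3 : P (‖x - y'‖ ^ 2) * G t ≤ 1 := mul_le_one₀ h1 (hG0 t).le h2
      simp only; linarith)
    (by
      intro x hx t ht
      have h2 := hGle t ht.2.le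
      have h1 : P (‖x - y'‖ ^ 2) ≤ c := by
        rw [hP, hc]
        simp only
        apply Real.exp_le_exp.2
        rw [dist_eq_norm] at hx
        have : (3 / 2 * r) ^ 2 ≤ ‖x - y'‖ ^ 2 := by rw [hx]
        have h3 := mul_le_mul_of_nonneg_left this hb0.le
        have h4 : b * (3 / 2 * r) ^ 2 = 9 / 4 * A := by rw [← hbr]; ring
        linarith
      have : P (‖x - y'‖ ^ 2) * G t ≤ c * 1 := mul_le_mul h1 h2 (hG0 t).le hc0.le
      simp only; linarith)
    (by
      rcases le_total (s - 3 * r ^ 2) 0 with h | h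
      · left; exact max_eq_left h
      · right
        rw [max_eq_right h]
        intro x
        have h2 : G (s - 3 * r ^ 2) ≤ c := by
          rw [hG, hc]
          simp only
          apply Real.exp_le_exp.2
          have : 5 / 2 * r ^ 2 ≤ T1 - (s - 3 * r ^ 2) := by linarith
          have h3 := mul_le_mul_of_nonneg_left this hb0.le
          have h4 : b * (5 / 2 * r ^ 2) = 5 / 2 * A := by rw [← hbr]; ring
          linarith
        have : P (‖x - y'‖ ^ 2) * G (s - 3 * r ^ 2) ≤ 1 * c :=
          mul_le_mul (hPle x) h2 (hG0 _).le zero_le_one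
        simp only; linarith)
    hxΩ (by linarith) (T := T) ⟨max_lt hT0 (by linarith), by linarith⟩
  refine le_trans (ENNReal.ofReal_le_ofReal ?_) key
  simp only [hP, hG]
  rw [← Real.exp_add]
  refine sub_le_sub_right (Real.exp_le_exp.2 ?_) _
  rw [dist_eq_norm] at hxy'
  have h1 : ‖x - y'‖ ^ 2 ≤ (5 / 4 * r) ^ 2 := by gcongr
  have h3 := mul_le_mul_of_nonneg_left h1 hb0.le
  have h4 : b * (5 / 4 * r) ^ 2 = 25 / 16 * A := by rw [← hbr]; ring
  have h5 : 9 / 10 * b * (T - T1) = -(9 / 20) * A := by rw [← hbr, hT1d]; ring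
  rw [h5]
  linarith

/-- Bottom case. -/
theorem bottom_case {n : ℕ} {ν : ℝ} {a : E n × ℝ → Fin n → Fin n → ℝ} {Ω : Set (E n)}
    {ω : E n × ℝ → Measure (E n × ℝ)} (hν : 0 < ν) (hΩ : IsOpen Ω)
    (ha : IsParabolicCoeff ν a (closure (Cyl Ω))) (hω : IsCaloricMeasure a Ω ω)
    {y : E n} {r : ℝ} (hr : 0 < r) {lam : ℝ}
    (hlam : lam = (8 * ν + 4 * (n / ν)) ^ 2 / (72 * ν))
    {x : E n} (hxΩ : x ∈ Ω) (hx : dist x y < r) {T : ℝ} (hT0 : 0 < T) (hT2 : T < r ^ 2) :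
    ENNReal.ofReal ((5 / 9) ^ 2 * Real.exp (-lam)) ≤ ω (x, T) (pB Ω ∩ Cr (y, 0) (2 * r)) := by
  have hr2 : 0 < r ^ 2 := by positivity
  have hlam0 : 0 ≤ lam := by rw [hlam]; positivity
  set b := lam / r ^ 2 with hb
  have hb0 : 0 ≤ b := div_nonneg hlam0 hr2.le
  have hbr : b * r ^ 2 = lam := by rw [hb]; field_simp
  -- truncated polynomial profile
  set k := (9 / 4 * r ^ 2)⁻¹ with hk
  have hk0 : 0 < k := by rw [hk]; positivity
  have hkr : k * (9 / 4 * r ^ 2) = 1 := by rw [hk]; field_simp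
  set P : ℝ → ℝ := fun q => (1 - k * q) ^ 2 with hP
  set G : ℝ → ℝ := fun t => Real.exp (-b * t) with hG
  have hP1 : ∀ q, HasDerivAt P (-2 * k * (1 - k * q)) q := by
    intro q
    have h : HasDerivAt (fun q => 1 - k * q) (-k) q := by
      simpa using ((hasDerivAt_id q).const_mul k).const_sub 1
    have h2 := h.pow 2
    have e : -2 * k * (1 - k * q) = ((2 : ℕ) : ℝ) * (1 - k * q) ^ (2 - 1) * (-k) := by
      norm_num; ring
    rw [e]
    exact h2
  have hP2 : ∀ q, HasDerivAt (fun q => -2 * k * (1 - k * q)) (2 * k ^ 2) q := by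
    intro q
    have h : HasDerivAt (fun q => 1 - k * q) (-k) q := by
      simpa using ((hasDerivAt_id q).const_mul k).const_sub 1
    have h2 := h.const_mul (-2 * k)
    have e : 2 * k ^ 2 = -2 * k * (-k) := by ring
    rw [e]
    exact h2
  have hG1 : ∀ t, HasDerivAt G (-b * G t) t := by
    intro t
    have := ((hasDerivAt_id t).const_mul (-b)).exp
    simpa [hG, mul_comm] using this
  have hG0 : ∀ q, 0 < G q := fun q => Real.exp_pos _
  have hGle : ∀ t, 0 ≤ t → G t ≤ 1 := by
    intro t ht
    rw [hG]; simp only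
    rw [Real.exp_le_one_iff]
    have := mul_nonneg hb0 ht
    linarith
  have hw : ∀ x : E n, ‖x - y‖ ≤ 3 / 2 * r → 0 ≤ 1 - k * ‖x - y‖ ^ 2 ∧ 1 - k * ‖x - y‖ ^ 2 ≤ 1 := by
    intro x hx
    have h1 : ‖x - y‖ ^ 2 ≤ (3 / 2 * r) ^ 2 := by gcongr
    have h2 := mul_le_mul_of_nonneg_left h1 hk0.le
    have h3 : k * (3 / 2 * r) ^ 2 = 1 := by rw [← hkr]; ring
    have h4 : 0 ≤ k * ‖x - y‖ ^ 2 := by positivity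
    exact ⟨by linarith, by linarith⟩
  have key := measure_lower (y := y) (s := 0) (r := r) (y' := y) (R := 3 / 2 * r)
    (t0 := 0) (t1 := 2 * r ^ 2)
    (v := fun X => P (‖X.1 - y‖ ^ 2) * G X.2 - 0) hν hΩ ha hω hr (by rw [dist_self]; linarith)
    le_rfl (by linarith) (by linarith)
    (contDiff_radial y (by rw [hP]; fun_prop) (by rw [hG]; fun_prop) 0)
    (by
      intro x hx hxR t ht
      rw [LVal_radial a y hP1 hP2 (hG1 t) x]
      have hmem : (x, t) ∈ closure (Cyl Ω) := subset_closure ⟨hx, ht.1⟩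
      obtain ⟨f1, f2⟩ := coeff_facts (ha.2 _ hmem).1 (ha.2 _ hmem).2 (x - y)
      set S := ∑ i, ∑ j, a (x, t) i j * (x - y) i * (x - y) j
      set tr := ∑ i, a (x, t) i i
      rw [dist_eq_norm] at hxR
      obtain ⟨w0, w1⟩ := hw x hxR.le
      set q := ‖x - y‖ ^ 2 with hq
      set w := 1 - k * q with hwd
      have e : G t * (4 * (2 * k ^ 2) * S + 2 * (-2 * k * w) * tr) - P q * (-b * G t) =
          G t * (8 * k ^ 2 * S - 4 * k * (w * tr) + b * w ^ 2) := by
        simp only [hP, hwd]; ring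
      rw [e]
      refine mul_nonneg (hG0 t).le ?_
      have h1 : k ^ 2 * (ν * q) ≤ k ^ 2 * S := mul_le_mul_of_nonneg_left f1 (by positivity)
      have h2 : k ^ 2 * (ν * q) = k * (ν * (1 - w)) := by rw [hwd]; ring
      have h3 : w * tr ≤ w * (n / ν) := mul_le_mul_of_nonneg_left f2 w0
      have h3' : k * (w * tr) ≤ k * (w * (n / ν)) := mul_le_mul_of_nonneg_left h3 hk0.le
      have h4 : b = k * (9 / 4 * lam) := by
        rw [← hbr]
        have : k * (9 / 4 * (b * r ^ 2)) = k * (9 / 4 * r ^ 2) * b := by ring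
        rw [this, hkr, one_mul]
      set B := 8 * ν + 4 * (n / ν) with hB
      have h5 : 8 * ν - B * w + 9 / 4 * lam * w ^ 2 = 8 * ν * (1 - B * w / (16 * ν)) ^ 2 := by
        rw [hlam]; field_simp; ring
      have h6 : 0 ≤ k * (8 * ν - B * w + 9 / 4 * lam * w ^ 2) := by
        rw [h5]; positivity
      have h7 : k * (8 * ν - B * w + 9 / 4 * lam * w ^ 2) =
          8 * (k * (ν * (1 - w))) - 4 * (k * (w * (n / ν))) + b * w ^ 2 := by
        rw [h4, hB]; ring
      linarith)
    (by
      intro x hx t ht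
      rw [dist_eq_norm] at hx
      obtain ⟨w0, w1⟩ := hw x hx
      have h1 : P (‖x - y‖ ^ 2) ≤ 1 := by
        simp only [hP]; exact pow_le_one₀ w0 w1
      have h3 : P (‖x - y‖ ^ 2) * G t ≤ 1 := mul_le_one₀ h1 (hG0 t).le (hGle t ht.1)
      simp only; linarith)
    (by
      intro x hx t ht
      rw [dist_eq_norm] at hx
      have h1 : P (‖x - y‖ ^ 2) = 0 := by
        simp only [hP, hx]
        have h3 : k * (3 / 2 * r) ^ 2 = 1 := by rw [← hkr]; ring
        rw [h3]; ring
      simp [h1])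
    (Or.inl rfl)
    hxΩ (by linarith) (T := T) ⟨hT0, by linarith⟩
  refine le_trans (ENNReal.ofReal_le_ofReal ?_) key
  simp only [sub_zero]
  rw [dist_eq_norm] at hx
  have h1 : 5 / 9 ≤ 1 - k * ‖x - y‖ ^ 2 := by
    have h1 : ‖x - y‖ ^ 2 ≤ r ^ 2 := by gcongr
    have h2 := mul_le_mul_of_nonneg_left h1 hk0.le
    linarith
  have h2 : (5 / 9) ^ 2 ≤ P (‖x - y‖ ^ 2) := by
    simp only [hP]; gcongr
  have h3 : Real.exp (-lam) ≤ G T := by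
    simp only [hG]
    apply Real.exp_le_exp.2
    have := mul_le_mul_of_nonneg_left hT2.le hb0
    linarith
  exact mul_le_mul h2 h3 (Real.exp_pos _).le ((by positivity : (0:ℝ) ≤ (5 / 9) ^ 2).trans h2)

theorem main_bound (n : ℕ) (hn : 0 < n) (ν : ℝ)
    (hν : ν ∈ Ioc (0 : ℝ) 1) (m : ℝ) :
    ∃ N : ℝ, 1 ≤ N ∧
      ∀ (r₀ : ℝ) (Ω : Set (E n)), IsLipschitzDomain hn Ω m r₀ →
      ∀ (a : E n × ℝ → Fin n → Fin n → ℝ), IsParabolicCoeff ν a (closure (Cyl Ω)) →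
      ∀ ω : E n × ℝ → Measure (E n × ℝ), IsCaloricMeasure a Ω ω →
      ∀ Y ∈ pB Ω, ∀ r : ℝ, 0 < r → r ≤ r₀ / 2 →
      ∀ X ∈ Cyl Ω ∩ Cr Y r,
        ENNReal.ofReal (1 / N) ≤ ω X (pB Ω ∩ Cr Y (2 * r)) := by
  have hν0 : 0 < ν := hν.1
  set δ := 1 / (4 * (1 + |m|)) with hδ
  have hδ0 : 0 < δ := by rw [hδ]; positivity
  set A := (2 * (n / ν) + 9 / 10) / (4 * ν * δ ^ 2) with hA
  have hA0 : 0 < A := by rw [hA]; positivity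
  have hA2 : 2 * (n / ν) + 9 / 10 ≤ 4 * A * ν * δ ^ 2 := by
    rw [hA]
    apply le_of_eq
    field_simp
  set lam := (8 * ν + 4 * (n / ν)) ^ 2 / (72 * ν) with hlam
  set c1 := Real.exp (-(161 / 80) * A) - Real.exp (-(9 / 4) * A) with hc1
  have hc10 : 0 < c1 := sub_pos.2 (Real.exp_lt_exp.2 (by nlinarith))
  set c2 := (5 / 9) ^ 2 * Real.exp (-lam) with hc2
  have hc20 : 0 < c2 := by positivity
  set N := 1 + 1 / c1 + 1 / c2 with hN
  have hp1 : 0 < 1 / c1 := by positivity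
  have hp2 : 0 < 1 / c2 := by positivity
  have hN1 : 1 / N ≤ c1 := by
    rw [one_div_le (by linarith) hc10]; linarith
  have hN2 : 1 / N ≤ c2 := by
    rw [one_div_le (by linarith) hc20]; linarith
  refine ⟨N, by linarith, ?_⟩
  rintro r₀ Ω hΩ a ha ω hω ⟨y, s⟩ hY r hr hr0 ⟨x, T⟩ ⟨⟨hxΩ, hT0⟩, hx, hT1, hT2⟩
  rcases hY with ⟨hy, -⟩ | ⟨hy, hs⟩
  · obtain ⟨y', hy', hext⟩ := exterior_ball hn hΩ hy hr hr0
    exact (ENNReal.ofReal_le_ofReal hN1).trans (lateral_case hν0 hΩ.1 ha hω hr hδ0 hy' hext hA0 hA2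
      hxΩ hx hT0 hT1 hT2)
  · have hs0 : s = 0 := hs
    subst hs0
    refine (ENNReal.ofReal_le_ofReal hN2).trans (bottom_case hν0 hΩ.1 ha hω hr hlam hxΩ hx hT0 ?_)
    have : T < 0 + r ^ 2 := hT2
    linarith

/-- **Lemma 4.1(b)**: for `Q = Ω × (0,∞)` over a Lipschitz domain `Ω`,
`Y = (y,s) ∈ ∂_pQ` and `0 < r ≤ r₀/2`, the `L`-caloric measure satisfies
`ω^X(Δ_{2r}(Y)) ≥ 1/N` for all `X ∈ Q_r(Y)`, where `N = N(n, ν, m) ≥ 1`. -/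
theorem caloric_measure_lower_bound_lipschitz (n : ℕ) (hn : 0 < n) (ν : ℝ)
    (hν : ν ∈ Ioc (0 : ℝ) 1) (m : ℝ) :
    ∃ N : ℝ, 1 ≤ N ∧
      ∀ (r₀ : ℝ) (Ω : Set (E n)), IsLipschitzDomain hn Ω m r₀ →
      ∀ (a : E n × ℝ → Fin n → Fin n → ℝ), IsParabolicCoeff ν a (closure (Cyl Ω)) →
      ∀ ω : E n × ℝ → Measure (E n × ℝ), IsCaloricMeasure a Ω ω →
      ∀ Y ∈ pB Ω, ∀ r : ℝ, 0 < r → r ≤ r₀ / 2 →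
      ∀ X ∈ Cyl Ω ∩ Cr Y r,
        ENNReal.ofReal (1 / N) ≤ ω X (pB Ω ∩ Cr Y (2 * r)) := by
  exact main_bound n hn ν hν m
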